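/- Suppose k > ℓ ≥ 1, k+ℓ ≥ 5, and 0 ≤ λ ≤ k+ℓ−5, with p = (k+ℓ)m+2+λ prime and n ≥ 1. Let τ ∈ (0,1] be feasible for 1/(k+ℓ), and assume m ≥ 5/τ and m ≥ (k+ℓ+λ+4)·(1+1/(k+ℓ))·(k+ℓ)^{1/(k+ℓ−2)}. If A ⊆ F_p^n is a nontrivial (k,ℓ)-sum-free set with |A| ≥ m·p^{n−1}, then A is normal, i.e., of type 1 or of type 2. -/

import Mathlib

open Pointwise

/-- `itSum h A` is the `h`-fold sumset `hA = A + ⋯ + A` (`h` copies), with `itSum 0 A = {0}`. -/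
def itSum {G : Type*} [AddCommMonoid G] : ℕ → Set G → Set G
  | 0, _ => {0}
  | h + 1, A => itSum h A + A

/-- `A` is `(k,ℓ)`-sum-free: the sumsets `kA` and `ℓA` are disjoint. -/
def KLFree {G : Type*} [AddCommMonoid G] (k l : ℕ) (A : Set G) : Prop :=
  itSum k A ∩ itSum l A = ∅

/-- The interval `[a, a+t] = {a, a+1, …, a+t}` in `ZMod p`. -/
def Ival {p : ℕ} (a : ZMod p) (t : ℕ) : Set (ZMod p) :=
  {x | ∃ i : ℕ, i ≤ t ∧ x = a + (i : ZMod p)}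

/-- The cuboid `[a, a+t] × F_p^{n'}` inside the model space `F_p × F_p^{n'}`. -/
def cub (p n' : ℕ) (a : ZMod p) (t : ℕ) : Set (ZMod p × (Fin n' → ZMod p)) :=
  {x | x.1 ∈ Ival a t}

/-- The element `a_j = -(km+1+j)·(k-ℓ)⁻¹` of `F_p`. -/
def ajElt (k l m p j : ℕ) : ZMod p :=
  -((k * m + 1 + j : ℕ) : ZMod p) * (((k - l : ℕ) : ZMod p))⁻¹

/-- The layer `A_i = (A - i·v) ∩ K` of `A` w.r.t. the decomposition `(v, K)`. -/
def layerKL {p n : ℕ} (v : Fin n → ZMod p) (K : Submodule (ZMod p) (Fin n → ZMod p))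
    (A : Set (Fin n → ZMod p)) (i : ZMod p) : Set (Fin n → ZMod p) :=
  {x | x ∈ K ∧ x + i • v ∈ A}

/-- The support `Supp(A) = {i | A_i ≠ ∅}` w.r.t. the decomposition `(v, K)`. -/
def supp {p n : ℕ} (v : Fin n → ZMod p) (K : Submodule (ZMod p) (Fin n → ZMod p))
    (A : Set (Fin n → ZMod p)) : Set (ZMod p) :=
  {i | (layerKL v K A i).Nonempty}

/-- The weight `ω(A) = |Supp(A)|` w.r.t. the decomposition `(v, K)`. -/
noncomputable def weight {p n : ℕ} (v : Fin n → ZMod p)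
    (K : Submodule (ZMod p) (Fin n → ZMod p)) (A : Set (Fin n → ZMod p)) : ℕ :=
  (supp v K A).ncard

/-- `A ⊆ F_p^n` is trivial: isomorphic to a subset of some extremal cuboid `A_{k,ℓ,p,j}`. -/
def IsTrivialKL (k l m lam p n : ℕ) (A : Set (Fin n → ZMod p)) : Prop :=
  ∃ (e : (Fin n → ZMod p) ≃+ (ZMod p × (Fin (n - 1) → ZMod p))) (j : ℕ),
    j < (lam + 2) / 2 ∧ e '' A ⊆ cub p (n - 1) (ajElt k l m p j) m

/-- Type 1. -/
def IsType1 (k l m lam p n : ℕ) (A : Set (Fin n → ZMod p)) : Prop :=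
  A.ncard = m * p ^ (n - 1) ∧
  ∃ (e : (Fin n → ZMod p) ≃+ (ZMod p × (Fin (n - 1) → ZMod p))) (a : ZMod p),
    ((l : ZMod p) * a - (k : ZMod p) * (a + (m : ZMod p) - 1) ∈ Ival (1 : ZMod p) (l - 1) ∨
      (lam + l + 2 ≤ k ∧
        (l : ZMod p) * a - (k : ZMod p) * (a + (m : ZMod p) - 1) ∈
          Ival ((lam + l + 2 : ℕ) : ZMod p) (k - (lam + l + 2)))) ∧
    e '' A = cub p (n - 1) a (m - 1)

/-- The element `a = m·k·(ℓ-k)⁻¹` of `F_p` used in type 2. -/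
def type2a (k l m p : ℕ) : ZMod p :=
  (m : ZMod p) * (k : ZMod p) * (((l : ZMod p) - (k : ZMod p))⁻¹)

/-- Type 2. -/
def IsType2 (k l m p n : ℕ) (A : Set (Fin n → ZMod p)) : Prop :=
  l = 1 ∧ 2 ≤ n ∧ A.ncard = m * p ^ (n - 1) ∧
  ∃ (e : (Fin n → ZMod p) ≃+ (ZMod p × (Fin (n - 1) → ZMod p)))
      (V : Submodule (ZMod p) (Fin (n - 1) → ZMod p)),
    V ≠ ⊤ ∧
    e '' A =
      ({type2a k l m p} ×ˢ (Set.univ \ (V : Set (Fin (n - 1) → ZMod p)))) ∪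
        ((Ival (type2a k l m p + 1) (m - 2)) ×ˢ (Set.univ : Set (Fin (n - 1) → ZMod p))) ∪
        ({type2a k l m p + (m : ZMod p)} ×ˢ (V : Set (Fin (n - 1) → ZMod p)))

/-- Normal: of type 1 or type 2. -/
def IsNormalKL (k l m lam p n : ℕ) (A : Set (Fin n → ZMod p)) : Prop :=
  IsType1 k l m lam p n A ∨ IsType2 k l m p n A

/-- The element `a = (ℓm+k-1)·(k-ℓ)⁻¹` of `F_p` used in type 3. -/
def type3a (k l m p : ℕ) : ZMod p :=
  ((l * m + k - 1 : ℕ) : ZMod p) * (((k - l : ℕ) : ZMod p))⁻¹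

/-- Type 3. -/
def IsType3 (k l m p n : ℕ) (A : Set (Fin n → ZMod p)) : Prop :=
  A.ncard = m * p ^ (n - 1) ∧
  ∃ e : (Fin n → ZMod p) ≃+ (ZMod p × (Fin (n - 1) → ZMod p)),
    e '' A = {x | x.1 ∈ Ival (type3a k l m p - 1) (m + 1) \
      {type3a k l m p, type3a k l m p + (m : ZMod p) - 1}}

/-- Type 4 (for `p = 5m+3`). -/
def IsType4 (m p n : ℕ) (A : Set (Fin n → ZMod p)) : Prop :=
  2 ≤ n ∧ A.ncard = m * p ^ (n - 1) ∧
  ∃ (e : (Fin n → ZMod p) ≃+ (ZMod p × (Fin (n - 1) → ZMod p)))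
      (V : Submodule (ZMod p) (Fin (n - 1) → ZMod p)),
    V ≠ ⊤ ∧
    e '' A =
      (({((2 * m + 1 : ℕ) : ZMod p), ((3 * m + 2 : ℕ) : ZMod p)} : Set (ZMod p)) ×ˢ
          (V : Set (Fin (n - 1) → ZMod p))) ∪
        (({((2 * m + 2 : ℕ) : ZMod p), ((3 * m + 1 : ℕ) : ZMod p)} : Set (ZMod p)) ×ˢ
          (Set.univ \ (V : Set (Fin (n - 1) → ZMod p)))) ∪
        ((Ival ((2 * m + 3 : ℕ) : ZMod p) (m - 3)) ×ˢ (Set.univ : Set (Fin (n - 1) → ZMod p)))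

/-- The set `A₀ ⊆ F_p × F_p^s` used in type 5 (for `p = 4m+3`), with `a = (m+2)/2`. -/
def type5A0 (m p s : ℕ) (P : Set (Fin s → ZMod p)) : Set (ZMod p × (Fin s → ZMod p)) :=
  {(((m + 2 : ℕ) : ZMod p) * (2 : ZMod p)⁻¹ - 1, (0 : Fin s → ZMod p))} ∪
    ({((m + 2 : ℕ) : ZMod p) * (2 : ZMod p)⁻¹} ×ˢ (Set.univ \ P)) ∪
    ((Ival (((m + 2 : ℕ) : ZMod p) * (2 : ZMod p)⁻¹ + 1) (m - 3)) ×ˢ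
      (Set.univ : Set (Fin s → ZMod p))) ∪
    ({((m + 2 : ℕ) : ZMod p) * (2 : ZMod p)⁻¹ + (m : ZMod p) - 1} ×ˢ
      (Set.univ \ {(0 : Fin s → ZMod p)})) ∪
    ({((m + 2 : ℕ) : ZMod p) * (2 : ZMod p)⁻¹ + (m : ZMod p)} ×ˢ P)

/-- Type 5 (for `p = 4m+3`). -/
def IsType5 (m p n : ℕ) (A : Set (Fin n → ZMod p)) : Prop :=
  A.ncard = m * p ^ (n - 1) ∧
  ∃ s : ℕ, s ≤ n - 1 ∧
    ∃ (e : (Fin n → ZMod p) ≃+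
          (ZMod p × (Fin s → ZMod p) × (Fin (n - 1 - s) → ZMod p)))
      (P : Set (Fin s → ZMod p)),
      P.Nonempty ∧ (0 : Fin s → ZMod p) ∉ itSum 3 P ∧
      e '' A = {x | (x.1, x.2.1) ∈ type5A0 m p s P}

/-- `τ` is feasible for `c`. -/
def Feasible (c τ : ℝ) : Prop :=
  ∀ q : ℕ, q.Prime → ∀ B : Set (ZMod q),
    (B.ncard : ℝ) ≤ c * q →
    ((B + B).ncard : ℝ) ≤ (2 + τ) * (B.ncard : ℝ) - 3 →
    ∃ y d : ZMod q, d ≠ 0 ∧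
      B ⊆ {x | ∃ i : ℕ, i ≤ (B + B).ncard - B.ncard ∧ x = y + (i : ZMod q) * d}

/-- `r` is a `σ`-weighted sum of elements of the sets `X j`, `j ∈ t`. -/
def Reach {ι R M : Type*} [AddCommMonoid M] [SMul R M] (σ : ι → R) (X : ι → Set M)
    (t : Finset ι) (r : M) : Prop :=
  ∃ g : ι → M, (∀ j ∈ t, g j ∈ X j) ∧ ∑ j ∈ t, σ j • g j = r

section Reach

variable {ι R M : Type*} [AddCommMonoid M] [SMul R M] {σ : ι → R} {X : ι → Set M}

theorem Reach.empty : Reach σ X ∅ 0 := by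
  exact ⟨fun _ => 0, by simp, by simp⟩

theorem Reach.single (j : ι) {x : M} (hx : x ∈ X j) : Reach σ X {j} (σ j • x) :=
  ⟨fun _ => x, by simpa using hx, by simp⟩

theorem Reach.union [DecidableEq ι] {s t : Finset ι} {r r' : M} (hst : Disjoint s t)
    (h : Reach σ X s r) (h' : Reach σ X t r') : Reach σ X (s ∪ t) (r + r') := by
  obtain ⟨g, hg, rfl⟩ := h
  obtain ⟨g', hg', rfl⟩ := h'
  refine ⟨fun j => if j ∈ s then g j else g' j, fun j hj => ?_, ?_⟩
  · by_cases hs : j ∈ s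
    · simpa [hs] using hg j hs
    · simpa [hs] using hg' j ((Finset.mem_union.1 hj).resolve_left hs)
  · rw [Finset.sum_union hst]
    congr 1
    · exact Finset.sum_congr rfl fun j hj => by simp [hj]
    · refine Finset.sum_congr rfl fun j hj => ?_
      have : j ∉ s := fun hs => Finset.disjoint_left.1 hst hs hj
      simp [this]

theorem Reach.insert [DecidableEq ι] {t : Finset ι} {r : M} {j : ι} {x : M} (hj : j ∉ t)
    (hx : x ∈ X j) (h : Reach σ X t r) : Reach σ X (insert j t) (σ j • x + r) := by
  rw [Finset.insert_eq]
  exact Reach.union (by simpa using hj) (Reach.single j hx) h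

theorem Reach.pair [DecidableEq ι] {i j : ι} {x y : M} (hij : i ≠ j)
    (hx : x ∈ X i) (hy : y ∈ X j) : Reach σ X {i, j} (σ i • x + σ j • y) :=
  Reach.insert (by simpa using hij) hx (Reach.single j hy)

end Reach

open Finset in
/-- Iterated Cauchy–Davenport for weighted sums. -/
theorem exists_reach_cauchyDavenport {p : ℕ} [Fact p.Prime] {ι : Type*} [DecidableEq ι]
    {σ : ι → ZMod p} (hσ : ∀ j, σ j ≠ 0) (X : ι → Finset (ZMod p)) (t : Finset ι)
    (hX : ∀ j ∈ t, (X j).Nonempty) :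
    ∃ S : Finset (ZMod p), S.Nonempty ∧
      (∀ r ∈ S, Reach σ (fun j => (X j : Set (ZMod p))) t r) ∧
      (p ≤ #S ∨ ∑ j ∈ t, #(X j) + 1 ≤ #S + #t) := by
  induction t using Finset.induction_on with
  | empty => exact ⟨{0}, by simp, by simpa using Reach.empty, by simp⟩
  | insert j t hj ih =>
    obtain ⟨S, hS, hr, hc⟩ := ih fun i hi => hX i (mem_insert_of_mem hi)
    have hXj := hX j (mem_insert_self j t)
    have hinj : Function.Injective (fun x : ZMod p => σ j • x) := fun a b h => by
      simpa [hσ j] using h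
    refine ⟨(X j).image (fun x => σ j • x) + S, (hXj.image _).add hS, ?_, ?_⟩
    · intro r hr'
      obtain ⟨a, ha, b, hb, rfl⟩ := Finset.mem_add.1 hr'
      obtain ⟨x, hx, rfl⟩ := Finset.mem_image.1 ha
      exact Reach.insert hj (by simpa using hx) (hr b hb)
    · have hcd := ZMod.cauchy_davenport (p := p) Fact.out (hXj.image (fun x => σ j • x)) hS
      rw [card_image_of_injective _ hinj] at hcd
      rw [sum_insert hj, card_insert_of_notMem hj]
      have h1 := hXj.card_pos
      rcases min_le_iff.1 hcd with h | h
      · exact Or.inl h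
      · rcases hc with hc | hc
        · left; omega
        · right; omega

open Finset in
theorem sum_card_of_not_reach {p : ℕ} [Fact p.Prime] {ι : Type*} [Fintype ι] [DecidableEq ι]
    {σ : ι → ZMod p} (hσ : ∀ j, σ j ≠ 0) (X : ι → Finset (ZMod p))
    (hX : ∀ j, (X j).Nonempty) {c : ZMod p}
    (h : ¬ Reach σ (fun j => (X j : Set (ZMod p))) univ c) :
    ∑ j, #(X j) + 2 ≤ p + Fintype.card ι := by
  obtain ⟨S, hS, hr, hc⟩ := exists_reach_cauchyDavenport hσ X univ fun j _ => hX j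
  have hlt : #S < p := by
    have : S ⊂ univ := by
      refine (ssubset_univ_iff).2 fun hu => h (hr c ?_)
      rw [hu]; exact mem_univ _
    simpa [ZMod.card] using card_lt_card this
  rw [card_univ] at hc
  omega

open Finset in
/-- A weak form of Kneser's theorem: if proper subgroups have at most `N` elements, a sumset
is everything or loses at most `N`. -/
theorem add_eq_univ_or_card_le {W : Type*} [AddCommGroup W] [Fintype W] [DecidableEq W] {N : ℕ}
    (hN : ∀ H : AddSubgroup W, H ≠ ⊤ → Nat.card H ≤ N) (X Y : Finset W)
    (hX : X.Nonempty) (hY : Y.Nonempty) :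
    X + Y = univ ∨ #X + #Y ≤ #(X + Y) + N := by
  induction hn : #Y using Nat.strong_induction_on generalizing X Y with
  | _ n ih =>
  subst hn
  by_cases hper : ∀ x ∈ X, ∀ y ∈ Y, ∀ y' ∈ Y, x + (y' - y) ∈ X
  · obtain ⟨y₀, hy₀⟩ := hY
    obtain ⟨x₀, hx₀⟩ := hX
    let H : AddSubgroup W := AddSubgroup.closure {w | ∃ y ∈ Y, w = y - y₀}
    have hXH : ∀ h ∈ H, ∀ x ∈ X, x + h ∈ X := by
      intro h hh
      refine AddSubgroup.closure_induction (p := fun h _ => ∀ x ∈ X, x + h ∈ X) ?_ ?_ ?_ ?_ hh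
      · rintro w ⟨y, hy, rfl⟩ x hx
        exact hper x hx _ hy₀ _ hy
      · simp
      · intro a b _ _ ha hb x hx
        rw [← add_assoc]
        exact hb _ (ha x hx)
      · intro a _ ha x hx
        have hmaps : Set.MapsTo (fun x => x + a) (X : Set W) X := fun x hx => ha x hx
        have hsurj := Finset.surj_on_of_inj_on_of_card_le (s := X) (t := X) (fun x _ => x + a)
          (fun x hx => ha x hx) (fun _ _ _ _ h => by simpa using h) le_rfl x hx
        obtain ⟨z, hz, rfl⟩ := hsurj
        simpa using hz
    by_cases hH : H = ⊤
    · left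
      have : X = univ := by
        ext w
        simp only [mem_univ, iff_true]
        have := hXH (w - x₀) (by rw [hH]; trivial) x₀ hx₀
        simpa using this
      ext w
      simp only [mem_univ, iff_true]
      exact Finset.mem_add.2 ⟨w - y₀, by simp [this], y₀, hy₀, by simp⟩
    · right
      have h1 : #Y ≤ N := by
        refine le_trans ?_ (hN H hH)
        have : Set.ncard ((fun y => y - y₀) '' (Y : Set W)) ≤ Set.ncard (H : Set W) := by
          refine Set.ncard_le_ncard ?_ (Set.toFinite _)
          rintro _ ⟨y, hy, rfl⟩
          exact AddSubgroup.subset_closure ⟨y, hy, rfl⟩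
        rwa [Set.ncard_image_of_injective _ (fun a b h => by simpa using h),
          Set.ncard_coe_finset, ← Nat.card_coe_set_eq] at this
      have h2 : #X ≤ #(X + Y) := card_le_card_add_right ⟨y₀, hy₀⟩
      omega
  · push Not at hper
    obtain ⟨x, hx, y, hy, y', hy', hxy⟩ := hper
    have hlt : #(addDysonETransform (x - y) (X, Y)).2 < #Y := by
      refine card_lt_card ⟨by simp [addDysonETransform, inter_subset_left], fun hsub => ?_⟩
      have := hsub hy'
      simp only [addDysonETransform, mem_inter] at this
      have h2 := this.2
      rw [Finset.mem_vadd_finset] at h2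
      obtain ⟨z, hz, hzy⟩ := h2
      apply hxy
      have : z = x + (y' - y) := by
        rw [← hzy]; simp only [vadd_eq_add]; abel
      rwa [← this]
    have hne : (addDysonETransform (x - y) (X, Y)).2.Nonempty := by
      refine ⟨y, ?_⟩
      simp only [addDysonETransform, mem_inter]
      refine ⟨hy, Finset.mem_vadd_finset.2 ⟨x, hx, ?_⟩⟩
      simp
    have hne1 : (addDysonETransform (x - y) (X, Y)).1.Nonempty := by
      refine hX.mono ?_
      simp [addDysonETransform, subset_union_left]
    have hsub := addDysonETransform.subset (x - y) (X, Y)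
    have hcard := addDysonETransform.card (x - y) (X, Y)
    rcases ih _ hlt _ _ hne1 hne rfl with h | h
    · left
      rw [eq_univ_iff_forall] at h ⊢
      exact fun w => hsub (h w)
    · right
      have := card_le_card hsub
      simp only at hcard this
      omega

theorem exists_reach {ι R M : Type*} [AddCommMonoid M] [SMul R M] {σ : ι → R} {X : ι → Set M}
    (t : Finset ι) (hX : ∀ j ∈ t, (X j).Nonempty) : ∃ r, Reach σ X t r := by
  classical
  choose! g hg using hX
  exact ⟨_, g, hg, rfl⟩

open Finset in
theorem Reach.of_pair {ι R M : Type*} [Fintype ι] [DecidableEq ι] [AddCommMonoid M] [SMul R M]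
    {σ : ι → R} {X : ι → Set M} {i j : ι} (hij : i ≠ j) {x y r : M} (hx : x ∈ X i) (hy : y ∈ X j)
    (h : Reach σ X (univ \ {i, j}) r) : Reach σ X univ (σ i • x + σ j • y + r) := by
  have := Reach.union disjoint_sdiff (Reach.pair (σ := σ) hij hx hy) h
  rwa [union_sdiff_of_subset (subset_univ _)] at this

open Finset in
theorem card_add_card_le_of_not_reach {p : ℕ} [Fact p.Prime] {W : Type*} [AddCommGroup W]
    [Module (ZMod p) W] [Fintype W] {ι : Type*} [Fintype ι] [DecidableEq ι]
    {σ : ι → ZMod p} (hσ : ∀ j, σ j ≠ 0) (Y : ι → Finset W) (hY : ∀ j, (Y j).Nonempty) {c : W}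
    (h : ¬ Reach σ (fun j => (Y j : Set W)) univ c) {i j : ι} (hij : i ≠ j) :
    #(Y i) + #(Y j) ≤ Fintype.card W := by
  classical
  obtain ⟨r, hr⟩ := exists_reach (σ := σ) (X := fun j => (Y j : Set W)) (univ \ {i, j})
    fun j _ => by simpa using hY j
  have hinj : Function.Injective (fun x : W => (σ j)⁻¹ • (c - r - σ i • x)) := by
    intro a b hab
    have h1 : c - r - σ i • a = c - r - σ i • b := by
      have := congrArg (fun z => σ j • z) hab
      simpa [smul_smul, hσ j] using this
    have h2 : σ i • a = σ i • b := by simpa using h1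
    have := congrArg (fun z => (σ i)⁻¹ • z) h2
    simpa [smul_smul, hσ i] using this
  rw [← card_image_of_injective (Y i) hinj, ← card_union_of_disjoint, ← card_univ]
  · exact card_le_card (subset_univ _)
  · rw [disjoint_left]
    intro y hy hyj
    obtain ⟨x, hx, rfl⟩ := mem_image.1 hy
    apply h
    have := Reach.of_pair (σ := σ) (X := fun j => (Y j : Set W)) hij (x := x) hx hyj hr
    rw [smul_smul, mul_inv_cancel₀ (hσ j), one_smul] at this
    convert this using 1
    abel

open Finset in
theorem exists_reach_card_le {p : ℕ} [Fact p.Prime] {W : Type*} [AddCommGroup W]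
    [Module (ZMod p) W] [Fintype W] {N : ℕ}
    (hN : ∀ H : AddSubgroup W, H ≠ ⊤ → Nat.card H ≤ N) {ι : Type*} [DecidableEq ι]
    {σ : ι → ZMod p} (hσ : ∀ j, σ j ≠ 0) (Y : ι → Finset W) (t : Finset ι) (ht : t.Nonempty)
    (hY : ∀ j ∈ t, (Y j).Nonempty) :
    ∃ S : Finset W, S.Nonempty ∧ (∀ r ∈ S, Reach σ (fun j => (Y j : Set W)) t r) ∧
      (S = univ ∨ ∑ j ∈ t, #(Y j) ≤ #S + (#t - 1) * N) := by
  classical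
  have hinj : ∀ j, Function.Injective (fun x : W => σ j • x) := fun j a b hab => by
    have := congrArg (fun z => (σ j)⁻¹ • z) hab
    simpa [smul_smul, hσ j] using this
  induction ht using Finset.Nonempty.cons_induction with
  | singleton j =>
    refine ⟨(Y j).image (fun x => σ j • x), (hY j (by simp)).image _, ?_, Or.inr ?_⟩
    · intro r hr
      obtain ⟨x, hx, rfl⟩ := mem_image.1 hr
      exact Reach.single j (by simpa using hx)
    · simp [card_image_of_injective _ (hinj j)]
  | cons j t hj ht ih =>
    obtain ⟨S, hS, hr, hc⟩ := ih fun i hi => hY i (mem_cons_of_mem hi)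
    have hYj := (hY j (mem_cons_self j t)).image (fun x => σ j • x)
    refine ⟨(Y j).image (fun x => σ j • x) + S, hYj.add hS, ?_, ?_⟩
    · intro r hr'
      obtain ⟨a, ha, b, hb, rfl⟩ := Finset.mem_add.1 hr'
      obtain ⟨x, hx, rfl⟩ := mem_image.1 ha
      rw [cons_eq_insert]
      exact Reach.insert hj (by simpa using hx) (hr b hb)
    · have h1 := ht.card_pos
      rcases hc with hc | hc
      · left
        subst hc
        obtain ⟨a, ha⟩ := hYj
        ext w
        simp only [mem_univ, iff_true]
        exact Finset.mem_add.2 ⟨a, ha, w - a, by simp, by simp⟩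
      · rcases add_eq_univ_or_card_le hN _ _ hYj hS with h | h
        · exact Or.inl h
        · right
          rw [card_image_of_injective _ (hinj j)] at h
          rw [sum_cons, card_cons]
          obtain ⟨s, hs⟩ : ∃ s, #t = s + 1 := ⟨#t - 1, by omega⟩
          rw [hs] at hc ⊢
          simp only [Nat.add_sub_cancel] at hc ⊢
          rw [add_one_mul]
          omega

open Finset in
theorem sum_card_le_of_not_reach {p : ℕ} [Fact p.Prime] {W : Type*} [AddCommGroup W]
    [Module (ZMod p) W] [Fintype W] {N : ℕ}
    (hN : ∀ H : AddSubgroup W, H ≠ ⊤ → Nat.card H ≤ N) {ι : Type*} [Fintype ι] [DecidableEq ι]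
    {σ : ι → ZMod p} (hσ : ∀ j, σ j ≠ 0) (Y : ι → Finset W) (hY : ∀ j, (Y j).Nonempty) {c : W}
    (h : ¬ Reach σ (fun j => (Y j : Set W)) univ c) (hι : 2 ≤ Fintype.card ι) :
    ∑ j, #(Y j) ≤ Fintype.card W + (Fintype.card ι - 2) * N := by
  classical
  obtain ⟨j⟩ : Nonempty ι := Fintype.card_pos_iff.1 (by omega)
  have hcard : #(univ.erase j) = Fintype.card ι - 1 := by
    rw [card_erase_of_mem (mem_univ j), card_univ]
  obtain ⟨S, hS, hr, hc⟩ := exists_reach_card_le hN hσ Y (univ.erase j)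
    (card_pos.1 (by omega)) fun i _ => hY i
  have hinj : Function.Injective (fun x : W => c - σ j • x) := by
    intro a b hab
    have h2 : σ j • a = σ j • b := by simpa using hab
    have := congrArg (fun z => (σ j)⁻¹ • z) h2
    simpa [smul_smul, hσ j] using this
  have hdisj : Disjoint ((Y j).image (fun x => c - σ j • x)) S := by
    rw [disjoint_left]
    intro s hs hsS
    obtain ⟨x, hx, rfl⟩ := mem_image.1 hs
    have := Reach.insert (notMem_erase j univ) (x := x) (by simpa using hx) (hr _ hsS)
    rw [insert_erase (mem_univ j)] at this
    exact h (by simpa using this)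
  have hle : #(Y j) + #S ≤ Fintype.card W := by
    rw [← card_image_of_injective (Y j) hinj, ← card_union_of_disjoint hdisj, ← card_univ]
    exact card_le_card (subset_univ _)
  have hYj := (hY j).card_pos
  rcases hc with hc | hc
  · rw [hc, card_univ] at hle
    omega
  · rw [← add_sum_erase _ _ (mem_univ j)]
    rw [hcard, Nat.sub_sub] at hc
    norm_num at hc ⊢
    omega

/-- The signs `+1` (`k` times) and `-1` (`l` times). -/
def sgn (p k l : ℕ) : Fin k ⊕ Fin l → ZMod p := Sum.elim (fun _ => 1) (fun _ => -1)

theorem sgn_ne_zero {p k l : ℕ} [Fact p.Prime] (j : Fin k ⊕ Fin l) : sgn p k l j ≠ 0 := by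
  cases j <;> simp [sgn]

/-- `A` is `(k,l)`-sum-free, phrased with weighted sums. -/
def SumFree (p : ℕ) {M : Type*} [AddCommGroup M] [Module (ZMod p) M] (k l : ℕ) (A : Set M) :
    Prop :=
  ¬ Reach (sgn p k l) (fun _ => A) Finset.univ 0

/-- The numerical hypotheses. -/
structure Params (k l m lam p : ℕ) : Prop where
  hlk : l < k
  hl : 1 ≤ l
  hkl : 5 ≤ k + l
  hlam : lam + 5 ≤ k + l
  hp : p = (k + l) * m + 2 + lam
  hm : k + l + lam + 5 ≤ m

/-- The layer of `A` over `i`. -/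
noncomputable def lay {I W : Type*} [Fintype W] (A : Set (I × W)) (i : I) : Finset W :=
  @Finset.filter W (fun w => (i, w) ∈ A) (Classical.decPred _) Finset.univ

theorem mem_lay {I W : Type*} [Fintype W] {A : Set (I × W)} {i : I} {w : W} :
    w ∈ lay A i ↔ (i, w) ∈ A := by
  simp [lay]

open Finset in
theorem ncard_eq_sum_card_lay {I W : Type*} [Fintype I] [Fintype W] (A : Set (I × W)) :
    A.ncard = ∑ i, #(lay A i) := by
  classical
  rw [Set.ncard_eq_toFinset_card A (Set.toFinite A), ← card_sigma]
  refine card_bij (fun x _ => ⟨x.1, x.2⟩) ?_ ?_ ?_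
  · intro x hx
    simpa [mem_lay] using hx
  · rintro ⟨a, b⟩ _ ⟨c, d⟩ _ h
    simp at h
    simp [h]
  · rintro ⟨i, w⟩ hx
    simp [mem_lay] at hx
    exact ⟨(i, w), by simpa using hx, rfl⟩

theorem card_lay_le {I W : Type*} [Fintype W] (A : Set (I × W)) (i : I) :
    (lay A i).card ≤ Fintype.card W := Finset.card_le_univ _

open Finset in
theorem SumFree.not_reach_lay {p k l : ℕ} {W : Type*} [AddCommGroup W] [Module (ZMod p) W]
    [Fintype W] {A : Set (ZMod p × W)} (hA : SumFree p k l A) {i : Fin k ⊕ Fin l → ZMod p}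
    (hi : ∑ j, sgn p k l j * i j = 0) :
    ¬ Reach (sgn p k l) (fun j => (lay A (i j) : Set W)) univ 0 := by
  rintro ⟨g, hg, h0⟩
  refine hA ⟨fun j => (i j, g j), fun j _ => ?_, ?_⟩
  · have := hg j (mem_univ j)
    exact mem_lay.1 this
  · ext1
    · simpa [Prod.fst_sum] using hi
    · simpa [Prod.snd_sum] using h0

open Finset in
theorem sum_ite_pair {ι α β : Type*} [Fintype ι] [DecidableEq ι] [AddCommMonoid β]
    (f : ι → α → β) {i j : ι} (hij : i ≠ j) (u v : α) (w : ι → α) :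
    ∑ a, f a (if a = i then u else if a = j then v else w a) =
      f i u + f j v + ∑ a ∈ univ \ {i, j}, f a (w a) := by
  rw [← sum_sdiff (subset_univ {i, j}), add_comm, sum_pair hij]
  congr 1
  · simp [hij.symm]
  · refine sum_congr rfl fun a ha => ?_
    simp at ha
    simp [ha]

open Finset in
theorem SumFree.card_lay_add_le {p k l : ℕ} [Fact p.Prime] {W : Type*} [AddCommGroup W]
    [Module (ZMod p) W] [Fintype W] {A : Set (ZMod p × W)} (hA : SumFree p k l A)
    {i : Fin k ⊕ Fin l → ZMod p} (hi : ∑ j, sgn p k l j * i j = 0)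
    (hne : ∀ j, (lay A (i j)).Nonempty) {a b : Fin k ⊕ Fin l} (hab : a ≠ b) :
    #(lay A (i a)) + #(lay A (i b)) ≤ Fintype.card W :=
  card_add_card_le_of_not_reach sgn_ne_zero (fun j => lay A (i j)) hne (hA.not_reach_lay hi) hab

open Finset in
theorem SumFree.not_reach {p k l : ℕ} [Fact p.Prime] {W : Type*} [AddCommGroup W]
    [Module (ZMod p) W] [Fintype W] {A : Set (ZMod p × W)} (hA : SumFree p k l A)
    (X : Fin k ⊕ Fin l → Set (ZMod p)) (hX : ∀ j, ∀ i ∈ X j, (lay A i).Nonempty)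
    {a b : Fin k ⊕ Fin l} (hab : a ≠ b)
    (h : ∀ u ∈ X a, ∀ v ∈ X b, Fintype.card W < #(lay A u) + #(lay A v)) :
    ¬ Reach (sgn p k l) X univ 0 := by
  rintro ⟨g, hg, h0⟩
  have := hA.card_lay_add_le h0 (fun j => hX j _ (hg j (mem_univ j))) hab
  have := h _ (hg a (mem_univ a)) _ (hg b (mem_univ b))
  omega

section LaySupp

variable {m p : ℕ} [Fact p.Prime] {W : Type*} [Fintype W] {A : Set (ZMod p × W)}

open Finset in
/-- The set of all `i` with nonempty layer. -/
noncomputable def laySupp (A : Set (ZMod p × W)) : Finset (ZMod p) :=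
  @Finset.filter (ZMod p) (fun i => (lay A i).Nonempty) (Classical.decPred _) univ

theorem mem_laySupp {i : ZMod p} : i ∈ laySupp A ↔ (lay A i).Nonempty := by
  simp [laySupp]

open Finset in
theorem ncard_eq_sum_laySupp (A : Set (ZMod p × W)) :
    A.ncard = ∑ i ∈ laySupp A, #(lay A i) := by
  rw [ncard_eq_sum_card_lay]
  refine (sum_subset (subset_univ _) fun i _ hi => ?_).symm
  simpa [mem_laySupp] using hi

open Finset in
theorem le_card_laySupp [Nonempty W] (hAc : m * Fintype.card W ≤ A.ncard) : m ≤ #(laySupp A) := by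
  rw [ncard_eq_sum_laySupp] at hAc
  have h := sum_le_card_nsmul (laySupp A) (fun i => #(lay A i)) _ fun i _ => card_lay_le A i
  exact Nat.le_of_mul_le_mul_right (hAc.trans h) Fintype.card_pos

end LaySupp

section Layers

variable {k l m lam p : ℕ} [Fact p.Prime] {W : Type*} [AddCommGroup W] [Module (ZMod p) W]
  [Fintype W] {A : Set (ZMod p × W)}

open Finset in
theorem exists_half_lt_card_lay (H : Params k l m lam p) (hA : SumFree p k l A)
    (hAc : m * Fintype.card W ≤ A.ncard)
    (hF : ∀ M, (∀ i, #(lay A i) ≤ M) → 2 * Fintype.card W + A.ncard ≤ p * M)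
    (hW : Fintype.card W = 1 ∨ ∃ N, Fintype.card W = p * N ∧
      ∀ H : AddSubgroup W, H ≠ ⊤ → Nat.card H ≤ N) :
    ∃ i, Fintype.card W < 2 * #(lay A i) := by
  classical
  obtain ⟨i₀, -, hi₀⟩ := exists_max_image (univ : Finset (ZMod p)) (fun i => #(lay A i)) ⟨0, mem_univ _⟩
  replace hi₀ : ∀ i, #(lay A i) ≤ #(lay A i₀) := fun i => hi₀ i (mem_univ i)
  have hFM := hF _ hi₀
  have hP : 0 < Fintype.card W := Fintype.card_pos
  have hM : 0 < #(lay A i₀) := by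
    by_contra h
    have h0 : #(lay A i₀) = 0 := by omega
    rw [h0] at hFM
    omega
  have hsum := ncard_eq_sum_card_lay A
  obtain ⟨hlk, hl, hkl, hlam, hp, hm⟩ := H
  rcases hW with hW | ⟨N, hPN, hN⟩
  · exact ⟨i₀, by omega⟩
  by_contra! hhalf
  have hrel : ∀ i : Fin k ⊕ Fin l → ZMod p, ∑ j, sgn p k l j * i j = 0 →
      (∀ j, (lay A (i j)).Nonempty) →
      ∑ j, #(lay A (i j)) ≤ Fintype.card W + (k + l - 2) * N := by
    intro i hi hne
    have := sum_card_le_of_not_reach hN sgn_ne_zero (fun j => lay A (i j)) hne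
      (hA.not_reach_lay hi) (by simp; omega)
    simpa using this
  obtain ⟨q, hq⟩ : ∃ q, k + l = q + 2 := ⟨k + l - 2, by omega⟩
  have hq2 : k + l - 2 = q := by omega
  rw [hq2] at hrel
  rw [hq] at hp
  set U := Fintype.card W + q * N with hU
  set M := #(lay A i₀) with hMdef
  set P := Fintype.card W with hPdef
  -- the two distinguished slots
  let s₀ : Fin k ⊕ Fin l := Sum.inl ⟨0, by omega⟩
  let s₁ : Fin k ⊕ Fin l := Sum.inl ⟨1, by omega⟩
  have hs : s₀ ≠ s₁ := by simp [s₀, s₁]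
  have hcard2 : #((univ : Finset (Fin k ⊕ Fin l)) \ {s₀, s₁}) = q := by
    rw [card_sdiff_of_subset (subset_univ _), card_pair hs]
    simp [hq]
  obtain ⟨c, hc⟩ : ∃ c : ZMod p, ∀ u, 0 < #(lay A u) → 0 < #(lay A (c - u)) →
      #(lay A u) + #(lay A (c - u)) + q * M ≤ U := by
    refine ⟨-∑ a ∈ univ \ {s₀, s₁}, sgn p k l a * i₀, fun u hu hv => ?_⟩
    set v := -∑ a ∈ univ \ {s₀, s₁}, sgn p k l a * i₀ - u with hvdef
    have := hrel (fun a => if a = s₀ then u else if a = s₁ then v else i₀) ?_ ?_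
    · rw [sum_ite_pair (fun _ x => #(lay A x)) hs u v (fun _ => i₀)] at this
      rw [sum_const, hcard2, smul_eq_mul] at this
      exact this
    · rw [sum_ite_pair (fun a x => sgn p k l a * x) hs u v (fun _ => i₀)]
      simp only [hvdef, sgn, s₀, s₁, Sum.elim_inl]
      ring
    · intro j
      split_ifs
      · exact card_pos.1 hu
      · exact card_pos.1 hv
      · exact card_pos.1 hM
  have hcsum : ∑ u, #(lay A (c - u)) = ∑ u, #(lay A u) :=
    Equiv.sum_comp (Equiv.subLeft c) (fun u => #(lay A u))
  have hcardp : #(univ : Finset (ZMod p)) = p := by rw [card_univ, ZMod.card]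
  have hpU : p * U = (p + q) * P := by rw [hU, hPN]; ring
  have hm2 : m * P * 2 ≤ 2 * ∑ i, #(lay A i) := by omega
  by_cases hcase : (q + 1) * M ≤ U
  · have h1 : ∀ u ∈ (univ : Finset (ZMod p)), #(lay A u) + #(lay A (c - u)) + q * M ≤ U := by
      intro u _
      have h2 := hi₀ u
      have h3 := hi₀ (c - u)
      rw [add_one_mul] at hcase
      rcases Nat.eq_zero_or_pos #(lay A u) with h | h
      · omega
      rcases Nat.eq_zero_or_pos #(lay A (c - u)) with h' | h'
      · omega
      exact hc u h h'
    have h2 := sum_le_sum h1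
    rw [sum_add_distrib, sum_add_distrib, hcsum, sum_const, sum_const, hcardp, smul_eq_mul,
      smul_eq_mul, hpU] at h2
    have h3 : q * (2 * P + m * P) ≤ p * (q * M) := by
      rw [mul_left_comm]
      exact Nat.mul_le_mul_left _ (by omega)
    have h4 : (m * 2 + q * (2 + m)) * P ≤ (p + q) * P := by
      linarith
    have h5 := Nat.le_of_mul_le_mul_right h4 hP
    rw [hp] at h5
    ring_nf at h5
    omega
  · push Not at hcase
    have h1 : ∀ u ∈ (univ : Finset (ZMod p)), #(lay A u) + #(lay A (c - u)) ≤ M := by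
      intro u _
      have h2 := hi₀ u
      have h3 := hi₀ (c - u)
      rw [add_one_mul] at hcase
      rcases Nat.eq_zero_or_pos #(lay A u) with h | h
      · omega
      rcases Nat.eq_zero_or_pos #(lay A (c - u)) with h' | h'
      · omega
      have := hc u h h'
      omega
    have h2 := sum_le_sum h1
    rw [sum_add_distrib, hcsum, sum_const, hcardp, smul_eq_mul] at h2
    have hqU : U ≤ q * M := by
      have h3 : (q * (m * 2)) * P ≤ p * (q * M) := by
        have := Nat.mul_le_mul_left q (show m * P * 2 ≤ p * M by omega)
        linarith
      have h4 : p * U ≤ p * (q * M) := by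
        rw [hpU]
        refine le_trans (Nat.mul_le_mul_right _ ?_) h3
        have : 3 * m ≤ q * m := Nat.mul_le_mul_right _ (by omega)
        rw [hp]
        ring_nf at this ⊢
        omega
      exact Nat.le_of_mul_le_mul_left h4 (Fact.out (p := p.Prime)).pos
    have hpair : ∀ u, 0 < #(lay A u) → 0 < #(lay A (c - u)) → False := fun u hu hv => by
      have := hc u hu hv
      omega
    set S := univ.filter (fun i : ZMod p => 0 < #(lay A i)) with hS
    have hS2 : 2 * #S ≤ p := by
      have hd : Disjoint S (S.image (fun u => c - u)) := by
        rw [disjoint_left]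
        intro u hu hu'
        obtain ⟨v, hv, rfl⟩ := mem_image.1 hu'
        exact hpair v (by simpa [hS] using hv) (by simpa [hS] using hu)
      have h3 := card_le_univ (S ∪ S.image (fun u => c - u))
      rw [card_union_of_disjoint hd, card_image_of_injective _ sub_right_injective, ZMod.card] at h3
      omega
    set T := univ.filter (fun i : ZMod p => U < (q + 2) * #(lay A i)) with hT
    have hTS : T ⊆ S := by
      intro i hi
      simp only [hT, hS, mem_filter, mem_univ, true_and] at hi ⊢
      by_contra h
      have h0 : #(lay A i) = 0 := by omega
      simp [h0] at hi
    have hTm : #T ≤ m + 1 := by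
      rcases T.eq_empty_or_nonempty with hTe | hTne
      · simp [hTe]
      have hnr : ¬ Reach (sgn p k l) (fun _ => (T : Set (ZMod p))) univ 0 := by
        rintro ⟨g, hg, h0⟩
        have hgT : ∀ j, U < (q + 2) * #(lay A (g j)) := fun j => by
          simpa [hT] using hg j (mem_univ j)
        have h3 := hrel g h0 fun j => by
          apply card_pos.1
          have := hgT j
          by_contra h
          have h0 : #(lay A (g j)) = 0 := by omega
          simp [h0] at this
        have h4 := sum_lt_sum_of_nonempty (s := (univ : Finset (Fin k ⊕ Fin l))) ⟨s₀, mem_univ _⟩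
          fun j _ => hgT j
        rw [sum_const, ← mul_sum, card_univ, Fintype.card_sum, Fintype.card_fin, Fintype.card_fin,
          hq, smul_eq_mul] at h4
        have := Nat.lt_of_mul_lt_mul_left h4
        omega
      have h3 := sum_card_of_not_reach sgn_ne_zero (fun _ => T) (fun _ => hTne) hnr
      rw [sum_const, card_univ, Fintype.card_sum, Fintype.card_fin, Fintype.card_fin,
          hq, smul_eq_mul] at h3
      by_contra h
      have h4 : (q + 2) * (m + 2) ≤ (q + 2) * #T := Nat.mul_le_mul_left _ (by omega)
      have h5 : lam ≤ q := by omega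
      linarith
    have hbound : ∀ i ∈ S, 2 * ((q + 2) * #(lay A i)) ≤
        2 * U + if i ∈ T then (q + 2) * P - 2 * U else 0 := by
      intro i hi
      split_ifs with h
      · have := Nat.mul_le_mul_left (q + 2) (hhalf i)
        rw [mul_left_comm] at this
        omega
      · simp [hT] at h
        omega
    have h4 := sum_le_sum hbound
    rw [sum_add_distrib, sum_const, sum_ite_mem, sum_const, inter_eq_right.2 hTS, smul_eq_mul,
      smul_eq_mul, ← mul_sum, ← mul_sum] at h4
    have h5 : ∑ i ∈ S, #(lay A i) = ∑ i, #(lay A i) := by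
      refine sum_subset (subset_univ _) fun i _ hi => ?_
      simpa [hS] using hi
    rw [h5, ← hsum] at h4
    have hUP : 2 * U ≤ (q + 2) * P := by
      have := Nat.mul_le_mul_right (q * N) (Fact.out (p := p.Prime)).two_le
      rw [hU, hPN]
      linarith
    obtain ⟨D, hD⟩ := Nat.le.dest hUP
    rw [← hD, Nat.add_sub_cancel_left] at h4
    have h6 : (#S) * (2 * U) ≤ p * U := by
      have := Nat.mul_le_mul_right U hS2
      linarith
    have h7 : #T * D ≤ (m + 1) * D := Nat.mul_le_mul_right _ hTm
    have h8 : D ≤ q * P := by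
      have : P ≤ U := by omega
      linarith
    have h9 : 2 * ((q + 2) * (m * P)) ≤ 2 * ((q + 2) * A.ncard) := by gcongr
    have h10 : (2 * (q + 2) * m) * P ≤ (p + q + (m + 1) * q) * P := by
      have := Nat.mul_le_mul_left (m + 1) h8
      linarith
    have h11 := Nat.le_of_mul_le_mul_right h10 hP
    rw [hp] at h11
    ring_nf at h11
    omega

open Finset in
theorem SumFree.card_add_card_add_le (H : Params k l m lam p) (hA : SumFree p k l A)
    {X Y : Finset (ZMod p)} (hX : X.Nonempty) (hY : Y.Nonempty) (hXS : X ⊆ laySupp A)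
    (hYS : Y ⊆ laySupp A)
    (hXY : ∀ u ∈ X, ∀ v ∈ Y, Fintype.card W < #(lay A u) + #(lay A v)) :
    #X + #Y + (k + l - 2) * #(laySupp A) ≤ p + (k + l - 2) := by
  classical
  obtain ⟨hlk, hl, hkl, hlam, hp, hm⟩ := H
  obtain ⟨q, hq⟩ : ∃ q, k + l = q + 2 := ⟨k + l - 2, by omega⟩
  have hq2 : k + l - 2 = q := by omega
  let s₀ : Fin k ⊕ Fin l := Sum.inl ⟨0, by omega⟩
  let s₁ : Fin k ⊕ Fin l := Sum.inl ⟨1, by omega⟩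
  have hs : s₀ ≠ s₁ := by simp [s₀, s₁]
  have hcard2 : #((univ : Finset (Fin k ⊕ Fin l)) \ {s₀, s₁}) = q := by
    rw [card_sdiff_of_subset (subset_univ _), card_pair hs]
    simp [hq]
  let Z : Fin k ⊕ Fin l → Finset (ZMod p) :=
    fun a => if a = s₀ then X else if a = s₁ then Y else laySupp A
  have hZ : ∀ j, Z j ⊆ laySupp A ∧ (Z j).Nonempty := by
    intro j
    simp only [Z]
    split_ifs
    · exact ⟨hXS, hX⟩
    · exact ⟨hYS, hY⟩
    · exact ⟨Subset.rfl, hX.mono hXS⟩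
  have h := sum_card_of_not_reach sgn_ne_zero Z (fun j => (hZ j).2)
    (hA.not_reach (fun j => (Z j : Set (ZMod p))) (fun j i hi => mem_laySupp.1 ((hZ j).1 hi)) hs
      (by simpa [Z, hs.symm] using hXY))
  rw [sum_ite_pair (fun _ x => #x) hs X Y (fun _ => laySupp A), sum_const, hcard2,
    Fintype.card_sum, Fintype.card_fin, Fintype.card_fin, hq, smul_eq_mul] at h
  rw [hq2]
  omega

open Finset in
theorem card_laySupp_le (H : Params k l m lam p) (hA : SumFree p k l A)
    (hAc : m * Fintype.card W ≤ A.ncard) (h2 : ∃ i, Fintype.card W < 2 * #(lay A i)) :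
    #(laySupp A) ≤ m + 1 := by
  classical
  obtain ⟨i₀, hi₀⟩ := h2
  have hi₀S : i₀ ∈ laySupp A := mem_laySupp.2 (card_pos.1 (by omega))
  have key := fun X Y => hA.card_add_card_add_le H (X := X) (Y := Y)
  have h0 := key {i₀} {i₀} (by simp) (by simp) (by simpa) (by simpa) (by simp; omega)
  obtain ⟨hlk, hl, hkl, hlam, hp, hm⟩ := H
  obtain ⟨q, hq⟩ : ∃ q, k + l = q + 2 := ⟨k + l - 2, by omega⟩
  have hq2 : k + l - 2 = q := by omega
  rw [hq2] at key h0
  rw [hq] at hp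
  simp only [card_singleton] at h0
  set P := Fintype.card W with hP
  have hP0 : 0 < P := Fintype.card_pos
  set s := #(laySupp A) with hs
  let T : ℕ → Finset (ZMod p) := fun t => univ.filter (fun i => t < #(lay A i))
  have hTS : ∀ t, T t ⊆ laySupp A := fun t i hi => by
    simp only [T, mem_filter] at hi
    exact mem_laySupp.2 (card_pos.1 (by omega))
  have hcake : ∑ i, #(lay A i) = ∑ t ∈ range P, #(T t) := by
    have := sum_card_bipartiteAbove_eq_sum_card_bipartiteBelow (s := (univ : Finset (ZMod p)))
      (t := range P) (fun i t => t < #(lay A i))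
    convert this using 2 with i
    swap
    · rfl
    rw [bipartiteAbove]
    have : filter (fun t => t < #(lay A i)) (range P) = range #(lay A i) := by
      ext t
      have := card_lay_le A i
      simp only [mem_filter, mem_range]
      omega
    rw [this, card_range]
  have hrefl := sum_range_reflect (fun t => #(T t)) P
  have hterm : ∀ t ∈ range P, #(T t) + #(T (P - 1 - t)) ≤ max s (p + q - q * s) := by
    intro t ht
    rw [mem_range] at ht
    rcases (T t).eq_empty_or_nonempty with h | h
    · rw [h, card_empty, zero_add]
      exact le_max_of_le_left (card_le_card (hTS _))
    rcases (T (P - 1 - t)).eq_empty_or_nonempty with h' | h'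
    · rw [h', card_empty, add_zero]
      exact le_max_of_le_left (card_le_card (hTS _))
    have := key _ _ h h' (hTS _) (hTS _) fun u hu v hv => by
      simp only [T, mem_filter] at hu hv
      omega
    exact le_max_of_le_right (by omega)
  have h3 := sum_le_sum hterm
  rw [sum_add_distrib, hrefl, ← hcake, sum_const, card_range, smul_eq_mul,
    ← ncard_eq_sum_card_lay] at h3
  have h4 : P * (2 * m) ≤ P * max s (p + q - q * s) := by
    linarith
  have h5 := Nat.le_of_mul_le_mul_left h4 hP0
  by_contra! hcon
  have h7 : q * (m + 2) ≤ q * s := Nat.mul_le_mul_left _ hcon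
  rcases le_max_iff.1 h5 with h6 | h6
  · have h8 : q * (2 * m) ≤ q * s := Nat.mul_le_mul_left _ h6
    have h9 : 3 * m ≤ q * m := Nat.mul_le_mul_right _ (by omega)
    ring_nf at hp h0 h8 h9
    omega
  · have h8 : 2 * m + q * s ≤ p + q := by omega
    ring_nf at hp h8 h7
    omega

end Layers

/-- The smallest contribution of a slot filled with `y` or `y + L • d`. -/
def slotMin {p k l : ℕ} (y d : ZMod p) (L : ℕ) : Fin k ⊕ Fin l → ZMod p :=
  Sum.elim (fun _ => y) (fun _ => -(y + L * d))

open Finset in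
theorem reach_progression {p k l : ℕ} {y d a : ZMod p} {L N : ℕ}
    {X : Fin k ⊕ Fin l → Set (ZMod p)} {t₀ t : Finset (Fin k ⊕ Fin l)} (ht : Disjoint t₀ t)
    (hy : ∀ j ∈ t, y ∈ X j) (hy' : ∀ j ∈ t, y + L * d ∈ X j) (hL : L ≤ N)
    (h : ∀ i < N, Reach (sgn p k l) X t₀ (a + i * d)) :
    ∀ i < N + #t * L, Reach (sgn p k l) X (t₀ ∪ t) (a + ∑ j ∈ t, slotMin y d L j + i * d) := by
  induction t using Finset.induction_on with
  | empty => simpa using h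
  | insert j t hj ih =>
    rw [disjoint_insert_right] at ht
    have ih := ih ht.2 (fun j hj => hy j (mem_insert_of_mem hj))
      fun j hj => hy' j (mem_insert_of_mem hj)
    intro i hi
    rw [card_insert_of_notMem hj, add_one_mul] at hi
    rw [union_insert, sum_insert hj]
    have hj' : j ∉ t₀ ∪ t := by simp [ht.1, hj]
    have hjy := hy j (mem_insert_self j t)
    have hjy' := hy' j (mem_insert_self j t)
    rcases lt_or_ge i (N + #t * L) with h1 | h1
    · rcases j with j | j
      · convert Reach.insert hj' hjy (ih i h1) using 1
        simp only [sgn, slotMin, Sum.elim_inl, smul_eq_mul]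
        ring
      · convert Reach.insert hj' hjy' (ih i h1) using 1
        simp only [sgn, slotMin, Sum.elim_inr, smul_eq_mul]
        ring
    · obtain ⟨i, rfl⟩ := Nat.exists_eq_add_of_le' (show L ≤ i by omega)
      rcases j with j | j
      · convert Reach.insert hj' hjy' (ih i (by omega)) using 1
        simp only [sgn, slotMin, Sum.elim_inl, smul_eq_mul]
        push_cast
        ring
      · convert Reach.insert hj' hjy (ih i (by omega)) using 1
        simp only [sgn, slotMin, Sum.elim_inr, smul_eq_mul]
        push_cast
        ring

theorem exists_eq_add_mul {p : ℕ} [Fact p.Prime] {d : ZMod p} (hd : d ≠ 0) (a r : ZMod p) :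
    ∃ i < p, r = a + (i : ZMod p) * d := by
  refine ⟨((r - a) * d⁻¹).val, ZMod.val_lt _, ?_⟩
  rw [ZMod.natCast_zmod_val, mul_assoc, inv_mul_cancel₀ hd]
  ring

theorem reach_zero_of_progression {p k l : ℕ} [Fact p.Prime] {d a : ZMod p} (hd : d ≠ 0) {N : ℕ}
    {X : Fin k ⊕ Fin l → Set (ZMod p)} {t : Finset (Fin k ⊕ Fin l)} (hN : p ≤ N)
    (h : ∀ i < N, Reach (sgn p k l) X t (a + i * d)) : Reach (sgn p k l) X t 0 := by
  obtain ⟨i, hi, h0⟩ := exists_eq_add_mul hd a 0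
  rw [h0]
  exact h i (by omega)

open Finset in
theorem reach_pair_of_sub {p k l : ℕ} {d : ZMod p} {R : ℕ} {X : Fin k ⊕ Fin l → Set (ZMod p)}
    {u : Fin k} {v : Fin l}
    (h : ∀ e ≤ R, ∃ b ∈ X (Sum.inl u), ∃ b' ∈ X (Sum.inr v), b - b' = e * d)
    (h' : ∀ e ≤ R, ∃ b ∈ X (Sum.inl u), ∃ b' ∈ X (Sum.inr v), b' - b = e * d) :
    ∀ i < 2 * R + 1, Reach (sgn p k l) X {Sum.inl u, Sum.inr v} (-(R * d) + i * d) := by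
  intro i hi
  rcases le_total R i with hR | hR
  · obtain ⟨e, rfl⟩ := Nat.exists_eq_add_of_le hR
    obtain ⟨b, hb, b', hb', hbb⟩ := h e (by omega)
    convert Reach.pair (σ := sgn p k l) (by simp) hb hb' using 1
    simp only [sgn, Sum.elim_inl, Sum.elim_inr, smul_eq_mul]
    push_cast
    linear_combination -hbb
  · obtain ⟨e, rfl⟩ := Nat.exists_eq_add_of_le hR
    obtain ⟨b, hb, b', hb', hbb⟩ := h' e (by omega)
    convert Reach.pair (σ := sgn p k l) (by simp) hb hb' using 1
    simp only [sgn, Sum.elim_inl, Sum.elim_inr, smul_eq_mul]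
    push_cast
    linear_combination hbb

/-- `B'` is a core of `B`: no zero-sum relation in `B` uses two entries from `B'`. -/
def IsCore (p k l : ℕ) (B B' : Set (ZMod p)) : Prop :=
  ∀ X : Fin k ⊕ Fin l → Set (ZMod p), (∀ j, X j ⊆ B) → ∀ a b, a ≠ b → X a ⊆ B' → X b ⊆ B' →
    ¬ Reach (sgn p k l) X Finset.univ 0

open Finset in
theorem SumFree.exists_core {k l m p : ℕ} [Fact p.Prime] {W : Type*} [AddCommGroup W]
    [Module (ZMod p) W] [Fintype W] {A : Set (ZMod p × W)} (hA : SumFree p k l A)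
    (hAc : m * Fintype.card W ≤ A.ncard) (hodd : Odd (Fintype.card W))
    (hS : #(laySupp A) ≤ m + 1) (hm : 2 ≤ m) :
    ∃ B' ⊆ laySupp A, #B' = m ∧ IsCore p k l (laySupp A) B' := by
  classical
  have hP : 0 < Fintype.card W := Fintype.card_pos
  have hbound : ∀ R ⊆ laySupp A,
      m * Fintype.card W ≤ ∑ i ∈ R, #(lay A i) + (#(laySupp A) - #R) * Fintype.card W := by
    intro R hR
    rw [ncard_eq_sum_laySupp, ← sum_sdiff hR] at hAc
    have := sum_le_card_nsmul (laySupp A \ R) (fun i => #(lay A i)) _ fun i _ => card_lay_le A i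
    rw [card_sdiff_of_subset hR, smul_eq_mul] at this
    omega
  suffices h : ∃ B' ⊆ laySupp A, #B' = m ∧
      ∀ u ∈ B', ∀ v ∈ B', Fintype.card W < #(lay A u) + #(lay A v) by
    obtain ⟨B', h1, h2, h3⟩ := h
    refine ⟨B', h1, h2, fun X hX a b hab ha hb => hA.not_reach X (fun j i hi => ?_) hab ?_⟩
    · exact mem_laySupp.1 (hX j hi)
    · exact fun u hu v hv => h3 u (ha hu) v (hb hv)
  have hm' := le_card_laySupp hAc
  set P := Fintype.card W with hPdef
  rcases Nat.lt_or_ge m #(laySupp A) with h | h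
  · have hs : #(laySupp A) = m + 1 := by omega
    obtain ⟨x, hx, hmin⟩ := exists_min_image (laySupp A) (fun i => #(lay A i))
      (card_pos.1 (by omega))
    refine ⟨(laySupp A).erase x, erase_subset _ _, by rw [card_erase_of_mem hx]; omega, ?_⟩
    intro u hu v hv
    obtain ⟨hux, huS⟩ := mem_erase.1 hu
    obtain ⟨hvx, hvS⟩ := mem_erase.1 hv
    have hux' := hmin u huS
    have hvx' := hmin v hvS
    have hup := card_lay_le A u
    by_cases huv : u = v
    · subst huv
      have := hbound {u, x} (by simp [insert_subset_iff, huS, hx])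
      rw [sum_pair hux, card_pair hux, hs] at this
      obtain ⟨M, rfl⟩ := Nat.exists_eq_add_of_le' (show 1 ≤ m by omega)
      rw [show M + 1 + 1 - 2 = M by omega, add_one_mul] at this
      obtain ⟨z, hz⟩ := hodd
      omega
    · have := hbound {u, v, x} (by simp [insert_subset_iff, huS, hvS, hx])
      rw [sum_insert (by simp [huv, hux]), sum_pair hvx, card_insert_of_notMem (by simp [huv, hux]),
        card_pair hvx, hs] at this
      obtain ⟨M, rfl⟩ := Nat.exists_eq_add_of_le' hm
      rw [show M + 2 + 1 - (2 + 1) = M by omega, add_mul] at this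
      omega
  · have hs : #(laySupp A) = m := by omega
    have hfull : ∀ u ∈ laySupp A, P ≤ #(lay A u) := by
      intro u hu
      have := hbound {u} (by simpa)
      rw [sum_singleton, card_singleton, hs] at this
      obtain ⟨M, rfl⟩ := Nat.exists_eq_add_of_le' (show 1 ≤ m by omega)
      rw [Nat.add_sub_cancel, add_one_mul] at this
      omega
    refine ⟨laySupp A, Subset.rfl, hs, fun u hu v hv => ?_⟩
    have := hfull u hu
    have := hfull v hv
    omega

open Finset in
theorem IsCore.disjoint_nsmul {p k l : ℕ} [Fact p.Prime] {B : Set (ZMod p)} {B' : Finset (ZMod p)}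
    (h : IsCore p k l B B') (hB : (B' : Set (ZMod p)) ⊆ B) (hk : 2 ≤ k) :
    Disjoint (k • B') (l • B') := by
  rw [disjoint_left]
  intro x hx hx'
  obtain ⟨f, hf⟩ := mem_nsmul.1 hx
  obtain ⟨g, hg⟩ := mem_nsmul.1 hx'
  refine h (fun _ => B') (fun _ => hB) (Sum.inl ⟨0, by omega⟩) (Sum.inl ⟨1, by omega⟩) (by simp)
    Set.Subset.rfl Set.Subset.rfl
    ⟨Sum.elim (fun i => f i) (fun i => g i), fun j _ => ?_, ?_⟩
  · cases j <;> simp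
  · rw [List.sum_ofFn] at hf hg
    rw [Fintype.sum_sum_type]
    simp [sgn, hf, hg]

open Finset in
theorem le_card_nsmul {p : ℕ} [Fact p.Prime] {B : Finset (ZMod p)} (hB : B.Nonempty) (n : ℕ) :
    p ≤ #(n • B) ∨ (n / 2) * (#(B + B) - 1) + (n % 2) * (#B - 1) + 1 ≤ #(n • B) := by
  induction n using Nat.strong_induction_on with
  | _ n ih =>
    match n with
    | 0 => right; simp
    | 1 =>
      right
      have := hB.card_pos
      simp
      omega
    | n + 2 =>
      have hBB := (hB.add hB).card_pos
      have hnB := (hB.nsmul (n := n)).card_pos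
      have h := ZMod.cauchy_davenport (Fact.out : p.Prime) (hB.nsmul (n := n)) (hB.add hB)
      rw [add_nsmul, two_nsmul, Nat.add_div_right _ (by norm_num), Nat.add_mod_right,
        Nat.succ_mul]
      rcases ih n (by omega) with h1 | h1
      · left
        refine le_trans ?_ h
        rw [le_min_iff]
        omega
      · rcases min_le_iff.1 h with h2 | h2
        · exact Or.inl h2
        · right
          omega

open Finset in
theorem IsCore.card_add_self_le {k l m lam p : ℕ} [Fact p.Prime] (H : Params k l m lam p)
    {B : Set (ZMod p)} {B' : Finset (ZMod p)} (h : IsCore p k l B B')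
    (hB : (B' : Set (ZMod p)) ⊆ B) (hm : #B' = m) : #(B' + B') ≤ 2 * m + 2 := by
  obtain ⟨hlk, hl, hkl, hlam, hp, hm5⟩ := H
  have hne : B'.Nonempty := card_pos.1 (by omega)
  have hd := h.disjoint_nsmul hB (by omega)
  have hle := card_le_univ (k • B' ∪ l • B')
  rw [card_union_of_disjoint hd, ZMod.card] at hle
  have hk0 := (hne.nsmul (n := k)).card_pos
  have hl0 := (hne.nsmul (n := l)).card_pos
  rcases le_card_nsmul hne k with hk | hk
  · omega
  rcases le_card_nsmul hne l with hl' | hl'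
  · omega
  by_contra! hcon
  have h1 : (k / 2) * (2 * m + 2) ≤ (k / 2) * (#(B' + B') - 1) := Nat.mul_le_mul_left _ (by omega)
  have h2 : (l / 2) * (2 * m + 2) ≤ (l / 2) * (#(B' + B') - 1) := Nat.mul_le_mul_left _ (by omega)
  have h3 : (k / 2) * (2 * m + 2) + (k % 2) * (#B' - 1) + (l / 2) * (2 * m + 2) +
    (l % 2) * (#B' - 1) + 2 ≤ p := by omega
  rw [hm, hp] at h3
  obtain ⟨M, rfl⟩ := Nat.exists_eq_add_of_le' (show 1 ≤ m by omega)
  rw [Nat.add_sub_cancel] at h3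
  have h4 : k = 2 * (k / 2) + k % 2 := by omega
  have h5 : l = 2 * (l / 2) + l % 2 := by omega
  have h6 : k % 2 < 2 := Nat.mod_lt _ (by norm_num)
  have h7 : l % 2 < 2 := Nat.mod_lt _ (by norm_num)
  generalize k / 2 = a at *
  generalize l / 2 = b at *
  generalize k % 2 = c at *
  generalize l % 2 = e at *
  rw [h4, h5] at h3
  ring_nf at h3
  omega

open Finset in
theorem exists_add_mem_of_card {S : Finset ℕ} {a L m e : ℕ} (hS : S ⊆ Icc a (a + L))
    (hc : #S = m) (hL : L ≤ m + 2) (hm : 10 ≤ m) (he : e < m) : ∃ s ∈ S, s + e ∈ S := by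
  by_contra! hcon
  rcases Nat.lt_or_ge L (2 * e) with h | h
  · have hinj : Set.InjOn (fun s => s % e) (S : Set ℕ) := by
      have key : ∀ s ∈ S, ∀ t ∈ S, s % e = t % e → s < t → False := by
        intro s hs t ht hst hlt
        have h1 := mem_Icc.1 (hS hs)
        have h2 := mem_Icc.1 (hS ht)
        have h3 : e ∣ t - s := (Nat.modEq_iff_dvd' hlt.le).1 hst
        obtain ⟨c, hc⟩ := h3
        have h4 : c = 1 := by
          have : c < 2 := by
            by_contra hge
            have : e * 2 ≤ e * c := Nat.mul_le_mul_left _ (by omega)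
            omega
          have : c ≠ 0 := by
            rintro rfl
            omega
          omega
        subst h4
        apply hcon s hs
        rwa [show s + e = t by omega]
      intro s hs t ht hst
      rcases lt_trichotomy s t with h1 | h1 | h1
      · exact (key s hs t ht hst h1).elim
      · exact h1
      · exact (key t ht s hs hst.symm h1).elim
    have := card_le_card_of_injOn (t := range e) (fun s => s % e)
      (fun s _ => by simpa using Nat.mod_lt _ (by omega)) hinj
    rw [card_range] at this
    omega
  · have hd : Disjoint S (S.image (fun s => s + e)) := by
      rw [disjoint_right]
      intro t ht
      obtain ⟨s, hs, rfl⟩ := mem_image.1 ht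
      exact hcon s hs
    have hsub : S ∪ S.image (fun s => s + e) ⊆ Icc a (a + L + e) := by
      intro t ht
      rw [mem_Icc]
      rcases mem_union.1 ht with ht | ht
      · have := mem_Icc.1 (hS ht)
        omega
      · obtain ⟨s, hs, rfl⟩ := mem_image.1 ht
        have := mem_Icc.1 (hS hs)
        omega
    have := card_le_card hsub
    rw [card_union_of_disjoint hd, card_image_of_injective _ (add_left_injective e),
      Nat.card_Icc] at this
    omega

theorem natCast_mul_inj {p : ℕ} [Fact p.Prime] {y d : ZMod p} (hd : d ≠ 0) {i j : ℕ} (hi : i < p)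
    (hj : j < p) (h : y + (i : ZMod p) * d = y + (j : ZMod p) * d) : i = j := by
  have h1 : (i : ZMod p) = j := mul_right_cancel₀ hd (add_left_cancel h)
  have h2 := congrArg ZMod.val h1
  rwa [ZMod.val_cast_of_lt hi, ZMod.val_cast_of_lt hj] at h2

open Finset in
theorem card_compl_pair {k l : ℕ} {a b : Fin k ⊕ Fin l} (hab : a ≠ b) :
    #((univ : Finset (Fin k ⊕ Fin l)) \ {a, b}) = k + l - 2 := by
  rw [card_sdiff_of_subset (subset_univ _), card_pair hab]
  simp

open Finset in
theorem IsCore.exists_progression {k l m lam p : ℕ} [Fact p.Prime] (H : Params k l m lam p)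
    {τ : ℝ} (hfeas : Feasible (1 / (k + l : ℝ)) τ) (hτ : 5 ≤ τ * m)
    {B : Set (ZMod p)} {B' : Finset (ZMod p)} (h : IsCore p k l B B')
    (hB : (B' : Set (ZMod p)) ⊆ B) (hm : #B' = m) :
    ∃ (y d : ZMod p) (L : ℕ), d ≠ 0 ∧ m - 1 ≤ L ∧ L ≤ m ∧ y ∈ B' ∧ y + L * d ∈ B' ∧
      (∀ b ∈ B', ∃ i ≤ L, b = y + (i : ℕ) * d) ∧
      ∀ e ≤ L, ∃ b ∈ B', ∃ b' ∈ B', b - b' = (e : ℕ) * d := by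
  classical
  have hcard := h.card_add_self_le H hB hm
  obtain ⟨hlk, hl, hkl, hlam, hp, hm5⟩ := H
  have hkl0 : (0 : ℝ) < (k : ℝ) + l := by
    have : (5 : ℝ) ≤ (k : ℝ) + l := by exact_mod_cast hkl
    linarith
  have hmp : 2 * m + 5 < p := by
    have : 5 * m ≤ (k + l) * m := Nat.mul_le_mul_right _ hkl
    omega
  obtain ⟨y₀, d, hd, hsub⟩ := hfeas p Fact.out (B' : Set (ZMod p))
    (by
      rw [Set.ncard_coe_finset, hm, one_div, ← div_eq_inv_mul, le_div_iff₀ hkl0]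
      have : m * (k + l) ≤ p := by
        rw [hp]
        nlinarith
      exact_mod_cast this)
    (by
      rw [← Finset.coe_add, Set.ncard_coe_finset, Set.ncard_coe_finset, hm]
      have : (#(B' + B') : ℝ) ≤ 2 * m + 2 := by exact_mod_cast hcard
      linarith)
  rw [← Finset.coe_add, Set.ncard_coe_finset, Set.ncard_coe_finset, hm] at hsub
  set S : Finset ℕ := (range (m + 3)).filter (fun i : ℕ => y₀ + (i : ZMod p) * d ∈ B') with hS
  have hmemS : ∀ {i : ℕ}, i ∈ S ↔ i < m + 3 ∧ y₀ + (i : ZMod p) * d ∈ B' := by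
    intro i
    simp [hS]
  have hrep : ∀ b ∈ B', ∃ i ∈ S, b = y₀ + (i : ZMod p) * d := by
    intro b hb
    obtain ⟨i, hi, rfl⟩ := hsub hb
    exact ⟨i, hmemS.2 ⟨by omega, hb⟩, rfl⟩
  have hSc : #S = m := by
    rw [← hm]
    refine card_bij (fun i _ => y₀ + (i : ZMod p) * d) (fun i hi => (hmemS.1 hi).2) ?_ ?_
    · intro i hi j hj hij
      have h1 := (hmemS.1 hi).1
      have h2 := (hmemS.1 hj).1
      exact natCast_mul_inj hd (by omega) (by omega) hij
    · intro b hb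
      obtain ⟨i, hi, rfl⟩ := hrep b hb
      exact ⟨i, hi, rfl⟩
  have hSne : S.Nonempty := card_pos.1 (by omega)
  set a := S.min' hSne with ha
  obtain ⟨L, hL⟩ := Nat.exists_eq_add_of_le (S.min'_le _ (S.max'_mem hSne))
  have haS : a ∈ S := S.min'_mem hSne
  have hLS : a + L ∈ S := hL ▸ S.max'_mem hSne
  have hSI : S ⊆ Icc a (a + L) := by
    intro s hs
    rw [mem_Icc]
    exact ⟨S.min'_le _ hs, hL ▸ S.le_max' _ hs⟩
  have hL2 : L ≤ m + 2 := by
    have := (hmemS.1 hLS).1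
    omega
  have hL1 : m - 1 ≤ L := by
    have := card_le_card hSI
    rw [Nat.card_Icc] at this
    omega
  have hy : y₀ + a * d ∈ B' := (hmemS.1 haS).2
  have hyL : y₀ + a * d + L * d ∈ B' := by
    have := (hmemS.1 hLS).2
    push_cast at this
    convert this using 1
    ring
  have hdiff : ∀ e < m, ∃ b ∈ B', ∃ b' ∈ B', b - b' = (e : ℕ) * d := by
    intro e he
    obtain ⟨s, hs, hse⟩ := exists_add_mem_of_card hSI hSc hL2 (by omega) he
    refine ⟨_, (hmemS.1 hse).2, _, (hmemS.1 hs).2, ?_⟩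
    push_cast
    ring
  have hLm : L ≤ m := by
    by_contra! hcon
    have hne : (Sum.inl ⟨0, by omega⟩ : Fin k ⊕ Fin l) ≠ Sum.inr ⟨0, by omega⟩ := by simp
    refine h (fun _ => B') (fun _ => hB) _ _ hne Set.Subset.rfl Set.Subset.rfl ?_
    have h1 := reach_pair_of_sub (X := fun _ : Fin k ⊕ Fin l => (B' : Set (ZMod p)))
      (u := ⟨0, by omega⟩) (v := ⟨0, by omega⟩) (R := m - 1)
      (fun e he => hdiff e (by omega)) fun e he => by
        obtain ⟨b, hb, b', hb', hbb⟩ := hdiff e (by omega)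
        exact ⟨b', hb', b, hb, hbb⟩
    have h2 := reach_progression (L := L) (t := univ \ {_, _}) disjoint_sdiff
      (fun j _ => hy) (fun j _ => hyL)
      (by omega) h1
    rw [union_sdiff_of_subset (subset_univ _), card_compl_pair hne] at h2
    refine reach_zero_of_progression hd ?_ h2
    have h3 : (k + l - 2) * (m + 1) ≤ (k + l - 2) * L := Nat.mul_le_mul_left _ hcon
    obtain ⟨q, hq⟩ : ∃ q, k + l = q + 2 := ⟨k + l - 2, by omega⟩
    rw [hq, Nat.add_sub_cancel] at h3 ⊢
    rw [hq] at hp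
    ring_nf at h3 hp ⊢
    omega
  refine ⟨y₀ + a * d, d, L, hd, hL1, hLm, hy, hyL, ?_, ?_⟩
  · intro b hb
    obtain ⟨i, hi, rfl⟩ := hrep b hb
    have := mem_Icc.1 (hSI hi)
    obtain ⟨c, rfl⟩ := Nat.exists_eq_add_of_le this.1
    refine ⟨c, by omega, ?_⟩
    push_cast
    ring
  · intro e he
    rcases Nat.lt_or_ge e m with h1 | h1
    · exact hdiff e h1
    · obtain rfl : e = L := by omega
      exact ⟨_, hyL, _, hy, by ring⟩

open Finset in
theorem IsCore.extra_point {k l m lam p : ℕ} [Fact p.Prime] (H : Params k l m lam p)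
    {B B' : Set (ZMod p)} (h : IsCore p k l B B') (hB : B' ⊆ B)
    {y d : ZMod p} {L g : ℕ} (hd : d ≠ 0) (hL1 : m - 1 ≤ L) (hL2 : L ≤ m) (hy : y ∈ B')
    (hyL : y + L * d ∈ B') (hdiff : ∀ e ≤ L, ∃ b ∈ B', ∃ b' ∈ B', b - b' = (e : ℕ) * d)
    (hg : 1 ≤ g) (hg2 : 2 * g ≤ p - L) (hx : y + (L + g : ℕ) * d ∈ B) : L + 1 = m ∧ g = 1 := by
  classical
  obtain ⟨hlk, hl, hkl, hlam, hp, hm5⟩ := H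
  obtain ⟨q, hq⟩ : ∃ q, k + l = q + 3 := ⟨k + l - 3, by omega⟩
  rw [hq] at hp
  let s₀ : Fin k ⊕ Fin l := Sum.inl ⟨0, by omega⟩
  let s₁ : Fin k ⊕ Fin l := Sum.inl ⟨1, by omega⟩
  let r₀ : Fin k ⊕ Fin l := Sum.inr ⟨0, by omega⟩
  have h01 : s₀ ≠ s₁ := by simp [s₀, s₁]
  have h0r : s₀ ≠ r₀ := by simp [s₀, r₀]
  have h1r : s₁ ≠ r₀ := by simp [s₁, r₀]
  let X : Fin k ⊕ Fin l → Set (ZMod p) := fun j => if j = s₀ ∨ j = r₀ then B' else B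
  have hXB : ∀ j, X j ⊆ B := fun j => by
    simp only [X]
    split_ifs
    · exact hB
    · exact Set.Subset.rfl
  have hX0 : X s₀ = B' := by simp [X]
  have hXr : X r₀ = B' := by simp [X]
  have hXB' : ∀ j, B' ⊆ X j := fun j => by
    simp only [X]
    split_ifs
    · exact Set.Subset.rfl
    · exact hB
  have hXo : ∀ j, j ≠ s₀ → j ≠ r₀ → X j = B := fun j h1 h2 => by simp [X, h1, h2]
  have hno := h X hXB s₀ r₀ h0r hX0.le hXr.le
  have hstart : ∀ i < 2 * L + 1, Reach (sgn p k l) X {s₀, r₀} (-(L * d) + i * d) := by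
    refine reach_pair_of_sub ?_ ?_
    · intro e he
      obtain ⟨b, hb, b', hb', hbb⟩ := hdiff e he
      exact ⟨b, hXB' _ hb, b', hXB' _ hb', hbb⟩
    · intro e he
      obtain ⟨b, hb, b', hb', hbb⟩ := hdiff e he
      exact ⟨b', hXB' _ hb', b, hXB' _ hb, hbb⟩
  obtain ⟨M, rfl⟩ := Nat.exists_eq_add_of_le' (show 1 ≤ m by omega)
  rw [Nat.add_sub_cancel] at hL1
  have hqM1 : 2 * M ≤ q * M := Nat.mul_le_mul_right _ (by omega)
  have hqL1 : q * M ≤ q * L := Nat.mul_le_mul_left _ hL1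
  -- a single slot may use the extra point
  have hgM : g ≤ M := by
    have h1 := reach_progression (L := L) (t := univ \ {s₀, r₀, s₁}) (by
        rw [disjoint_left]
        intro j hj
        simp only [mem_insert, mem_singleton] at hj
        rcases hj with rfl | rfl <;> simp) (fun j _ => hXB' _ hy)
      (fun j _ => hXB' _ hyL) (by omega) hstart
    have hc : #((univ : Finset (Fin k ⊕ Fin l)) \ {s₀, r₀, s₁}) = q := by
      rw [card_sdiff_of_subset (subset_univ _), card_insert_of_notMem (by simp [h0r, h01]),
        card_pair h1r.symm]
      simp
      omega
    have hu : {s₀, r₀} ∪ (univ : Finset (Fin k ⊕ Fin l)) \ {s₀, r₀, s₁} = univ \ {s₁} := by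
      ext j
      by_cases e0 : j = s₀
      · subst e0
        simp [h01]
      by_cases e1 : j = r₀
      · subst e1
        simp [h1r.symm]
      simp [e0, e1]
    rw [hc, hu] at h1
    have h2 := reach_progression (L := L + g) (t := {s₁}) sdiff_disjoint
      (fun j _ => hXB' _ hy)
      (fun j hj => by
        rw [mem_singleton] at hj
        subst hj
        rw [hXo _ h01.symm h1r]
        exact hx)
      (by
        have : q * M + q * 1 ≤ q * L + q := by omega
        have h3 : 2 * g ≤ p - L := hg2
        have h4 : q * 1 ≤ q * M := Nat.mul_le_mul_left _ (by omega)
        ring_nf at hp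
        omega) h1
    rw [sdiff_union_of_subset (subset_univ _), card_singleton] at h2
    by_contra! hcon
    refine hno (reach_zero_of_progression hd ?_ h2)
    have h5 : q * (M + 1) + L ≤ q * L + M + (q + 1) := by
      rcases Nat.lt_or_ge L (M + 1) with h6 | h6
      · obtain rfl : L = M := by omega
        ring_nf
        omega
      · obtain rfl : L = M + 1 := by omega
        omega
    ring_nf at hp h5 ⊢
    omega
  have h2 := reach_progression (L := L + g) (t := univ \ {s₀, r₀}) disjoint_sdiff
    (fun j _ => hXB' _ hy)
    (fun j hj => by
      simp only [mem_sdiff, mem_univ, true_and, mem_insert, mem_singleton, not_or] at hj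
      rw [hXo _ hj.1 hj.2]
      exact hx) (by omega) hstart
  rw [union_sdiff_of_subset (subset_univ _), card_compl_pair h0r] at h2
  have h3 : 2 * L + 1 + (k + l - 2) * (L + g) < p := by
    by_contra! hcon
    exact hno (reach_zero_of_progression hd hcon h2)
  rw [show k + l - 2 = q + 1 by omega] at h3
  have h4 : q * 1 ≤ q * g := Nat.mul_le_mul_left _ hg
  rcases Nat.lt_or_ge L (M + 1) with h6 | h6
  · obtain rfl : L = M := by omega
    refine ⟨rfl, ?_⟩
    by_contra hg1
    have h5 : q * 2 ≤ q * g := Nat.mul_le_mul_left _ (by omega)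
    ring_nf at hp h3 h5
    omega
  · obtain rfl : L = M + 1 := by omega
    ring_nf at hp h3 h4
    omega

open Finset in
/-- The support of a large sum-free set is contained in a progression of length `m + 1`. -/
theorem IsCore.exists_progression_of_card_le {k l m lam p : ℕ} [Fact p.Prime]
    (H : Params k l m lam p)
    {τ : ℝ} (hfeas : Feasible (1 / (k + l : ℝ)) τ) (hτ : 5 ≤ τ * m)
    {B B' : Finset (ZMod p)} (h : IsCore p k l B B') (hB : B' ⊆ B) (hm : #B' = m)
    (hBm : #B ≤ m + 1) :
    ∃ y d : ZMod p, d ≠ 0 ∧ ∀ b ∈ B, ∃ i ≤ m, b = y + (i : ℕ) * d := by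
  classical
  have hBs : (B' : Set (ZMod p)) ⊆ B := by exact_mod_cast hB
  obtain ⟨y, d, L, hd, hL1, hL2, hy, hyL, hrep, hdiff⟩ := h.exists_progression H hfeas hτ hBs hm
  by_cases hx : ∃ x ∈ B, x ∉ B'
  swap
  · push Not at hx
    refine ⟨y, d, hd, fun b hb => ?_⟩
    obtain ⟨i, hi, hbi⟩ := hrep b (hx b hb)
    exact ⟨i, by omega, hbi⟩
  obtain ⟨x, hxB, hxB'⟩ := hx
  have hBx : ∀ b ∈ B, b = x ∨ b ∈ B' := by
    have : insert x B' = B := by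
      refine eq_of_subset_of_card_le (by simp [insert_subset_iff, hxB, hB]) ?_
      rw [card_insert_of_notMem hxB']
      omega
    intro b hb
    rw [← this, mem_insert] at hb
    exact hb
  obtain ⟨e, he, hxe⟩ := exists_eq_add_mul hd y x
  have hfin : ∀ y' d' : ZMod p, d' ≠ 0 → (∃ i ≤ m, x = y' + (i : ℕ) * d') →
      (∀ b ∈ B', ∃ i ≤ m, b = y' + (i : ℕ) * d') →
      ∃ y d : ZMod p, d ≠ 0 ∧ ∀ b ∈ B, ∃ i ≤ m, b = y + (i : ℕ) * d := by
    intro y' d' hd' h1 h2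
    refine ⟨y', d', hd', fun b hb => ?_⟩
    rcases hBx b hb with rfl | hb
    · exact h1
    · exact h2 b hb
  have hmain : ∀ i, i ≤ L → i ≤ m := fun i hi => by omega
  rcases Nat.lt_or_ge m e with hem | hem
  swap
  · refine hfin y d hd ⟨e, hem, hxe⟩ fun b hb => ?_
    obtain ⟨i, hi, hbi⟩ := hrep b hb
    exact ⟨i, hmain i hi, hbi⟩
  rcases Nat.lt_or_ge (p - L) (2 * (e - L)) with h1 | h1
  · -- reflect
    have hrefl : y + L * d + (L + (p - e) : ℕ) * (-d) = x := by
      rw [hxe]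
      push_cast [Nat.cast_sub he.le]
      simp
      ring
    have h2 := h.extra_point H hBs (y := y + L * d) (d := -d) (L := L) (g := p - e)
      (neg_ne_zero.2 hd) hL1 hL2 hyL (by simpa using hy)
      (fun e he => by
        obtain ⟨b, hb, b', hb', hbb⟩ := hdiff e he
        exact ⟨b', hb', b, hb, by linear_combination -hbb⟩) (by omega) (by omega)
      (by rw [hrefl]; exact hxB)
    refine hfin (y + L * d) (-d) (neg_ne_zero.2 hd) ⟨_, ?_, hrefl.symm⟩ fun b hb => ?_
    · omega
    · obtain ⟨i, hi, hbi⟩ := hrep b hb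
      refine ⟨L - i, by omega, ?_⟩
      rw [hbi]
      push_cast [Nat.cast_sub hi]
      ring
  · have h2 := h.extra_point H hBs (g := e - L) hd hL1 hL2 hy hyL hdiff (by omega) h1
      (by rw [show L + (e - L) = e by omega, ← hxe]; exact hxB)
    omega

theorem Reach.map {ι R M N : Type*} [Semiring R] [AddCommMonoid M] [Module R M] [AddCommMonoid N]
    [Module R N] {σ : ι → R} {X : ι → Set M} {t : Finset ι} {r : M} (f : M →ₗ[R] N)
    (h : Reach σ X t r) : Reach σ (fun j => f '' X j) t (f r) := by
  obtain ⟨g, hg, rfl⟩ := h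
  exact ⟨fun j => f (g j), fun j hj => ⟨_, hg j hj, rfl⟩, by simp⟩

theorem SumFree.image {p k l : ℕ} {M N : Type*} [AddCommGroup M] [Module (ZMod p) M]
    [AddCommGroup N] [Module (ZMod p) N] {A : Set M} (hA : SumFree p k l A)
    (f : M ≃ₗ[ZMod p] N) : SumFree p k l (f '' A) := by
  intro h
  apply hA
  have := Reach.map (f.symm : N →ₗ[ZMod p] M) h
  simpa [Set.image_image] using this

/-- `A ⊆ F_p × F_p^{n'}` is trivial or normal, up to an automorphism. -/
def IsClassified (k l m lam p n' : ℕ) (A : Set (ZMod p × (Fin n' → ZMod p))) : Prop :=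
  (∃ (e : (ZMod p × (Fin n' → ZMod p)) ≃+ (ZMod p × (Fin n' → ZMod p))) (j : ℕ),
    j < (lam + 2) / 2 ∧ e '' A ⊆ cub p n' (ajElt k l m p j) m) ∨
  (A.ncard = m * p ^ n' ∧
    ∃ (e : (ZMod p × (Fin n' → ZMod p)) ≃+ (ZMod p × (Fin n' → ZMod p))) (a : ZMod p),
      ((l : ZMod p) * a - (k : ZMod p) * (a + (m : ZMod p) - 1) ∈ Ival (1 : ZMod p) (l - 1) ∨
      (lam + l + 2 ≤ k ∧
        (l : ZMod p) * a - (k : ZMod p) * (a + (m : ZMod p) - 1) ∈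
          Ival ((lam + l + 2 : ℕ) : ZMod p) (k - (lam + l + 2)))) ∧
      e '' A = cub p n' a (m - 1)) ∨
  (l = 1 ∧ 1 ≤ n' ∧ A.ncard = m * p ^ n' ∧
    ∃ (e : (ZMod p × (Fin n' → ZMod p)) ≃+ (ZMod p × (Fin n' → ZMod p)))
      (V : Submodule (ZMod p) (Fin n' → ZMod p)),
    V ≠ ⊤ ∧
    e '' A =
      ({type2a k l m p} ×ˢ (Set.univ \ (V : Set (Fin n' → ZMod p)))) ∪
        ((Ival (type2a k l m p + 1) (m - 2)) ×ˢ (Set.univ : Set (Fin n' → ZMod p))) ∪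
        ({type2a k l m p + (m : ZMod p)} ×ˢ (V : Set (Fin n' → ZMod p))))

theorem IsClassified.of_image {k l m lam p n' : ℕ} {A : Set (ZMod p × (Fin n' → ZMod p))}
    (f : (ZMod p × (Fin n' → ZMod p)) ≃+ (ZMod p × (Fin n' → ZMod p)))
    (h : IsClassified k l m lam p n' (f '' A)) : IsClassified k l m lam p n' A := by
  have hc : (f '' A).ncard = A.ncard := Set.ncard_image_of_injective _ f.injective
  have hi : ∀ e : (ZMod p × (Fin n' → ZMod p)) ≃+ (ZMod p × (Fin n' → ZMod p)),
      e '' (f '' A) = (f.trans e) '' A := by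
    intro e
    rw [Set.image_image]
    rfl
  rcases h with ⟨e, j, hj, h⟩ | ⟨h1, e, a, ha, h⟩ | ⟨h0, hn, h1, e, V, hV, h⟩
  · exact Or.inl ⟨f.trans e, j, hj, hi e ▸ h⟩
  · exact Or.inr (Or.inl ⟨hc ▸ h1, f.trans e, a, ha, hi e ▸ h⟩)
  · exact Or.inr (Or.inr ⟨h0, hn, hc ▸ h1, f.trans e, V, hV, hi e ▸ h⟩)

section

variable {k l m lam p n' : ℕ} [Fact p.Prime] {A : Set (ZMod p × (Fin n' → ZMod p))}

theorem Params.natCast_ne_zero (H : Params k l m lam p) {c : ℕ} (hc : 0 < c) (hcm : c ≤ m) :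
    (c : ZMod p) ≠ 0 := by
  obtain ⟨hlk, hl, hkl, hlam, hp, hm⟩ := H
  rw [Ne, ZMod.natCast_eq_zero_iff]
  intro h
  have := Nat.le_of_dvd hc h
  have : 5 * m ≤ (k + l) * m := Nat.mul_le_mul_right _ hkl
  omega

theorem Params.cast_eq (H : Params k l m lam p) :
    ((k : ZMod p) + l) * m + 2 + lam = 0 := by
  have h : (((k + l) * m + 2 + lam : ℕ) : ZMod p) = 0 := by
    rw [← H.hp]
    exact ZMod.natCast_self p
  push_cast at h
  exact h

theorem mem_Ival_neg {y t : ZMod p} {L : ℕ} (h : t ∈ Ival y L) :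
    -t ∈ Ival (-(y + (L : ZMod p))) L := by
  obtain ⟨i, hi, rfl⟩ := h
  refine ⟨L - i, by omega, ?_⟩
  push_cast [Nat.cast_sub hi]
  ring

theorem isClassified_of_subset_Ival (H : Params k l m lam p) {y : ZMod p} {j : ℕ} (hj : j ≤ lam)
    (hA : ∀ x ∈ A, x.1 ∈ Ival y m)
    (hy : ((k : ZMod p) - l) * y = -(k * m + 1 + j)) : IsClassified k l m lam p n' A := by
  have hkl : ((k - l : ℕ) : ZMod p) ≠ 0 :=
    H.natCast_ne_zero (by have := H.hlk; omega) (by have := H.hm; omega)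
  have key : ∀ (z : ZMod p) (i : ℕ), ((k : ZMod p) - l) * z = -(k * m + 1 + i) →
      z = ajElt k l m p i := by
    intro z i hz
    rw [ajElt, eq_mul_inv_iff_mul_eq₀ hkl, Nat.cast_sub H.hlk.le]
    push_cast
    linear_combination hz
  by_cases hj2 : j < (lam + 2) / 2
  · refine Or.inl ⟨AddEquiv.refl _, j, hj2, ?_⟩
    rintro _ ⟨x, hx, rfl⟩
    have := hA x hx
    rwa [key y j hy] at this
  · refine Or.inl ⟨AddEquiv.neg _, lam - j, by omega, ?_⟩
    rintro _ ⟨x, hx, rfl⟩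
    have := mem_Ival_neg (hA x hx)
    rw [key (-(y + m)) (lam - j)] at this
    · exact this
    · push_cast [Nat.cast_sub hj]
      linear_combination -hy + H.cast_eq

theorem isClassified_of_ne_zero (H : Params k l m lam p) {y : ZMod p}
    (hA : ∀ x ∈ A, x.1 ∈ Ival y m)
    (h : ∀ i ≤ (k + l) * m, (k : ZMod p) * y - l * (y + m) + (i : ℕ) ≠ 0) :
    IsClassified k l m lam p n' A := by
  set c : ZMod p := k * y - l * (y + m) with hc
  have hv : ((-c).val : ZMod p) = -c := ZMod.natCast_zmod_val _
  have hlt := ZMod.val_lt (-c)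
  have hgt : (k + l) * m < (-c).val := by
    by_contra! hcon
    apply h _ hcon
    rw [hv]
    ring
  obtain ⟨j, hj⟩ := Nat.exists_eq_add_of_le hgt
  rw [hj] at hv
  have hp := H.hp
  refine isClassified_of_subset_Ival H (j := j) (by omega) hA ?_
  push_cast at hv
  linear_combination hv - hc

open Finset in
theorem reach_of_sub {y d : ZMod p} {L R : ℕ} {X : Fin k ⊕ Fin l → Set (ZMod p)}
    (hk : 0 < k) (hl : 0 < l)
    (hy : ∀ j, j ≠ Sum.inl ⟨0, hk⟩ → j ≠ Sum.inr ⟨0, hl⟩ → y ∈ X j)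
    (hyL : ∀ j, j ≠ Sum.inl ⟨0, hk⟩ → j ≠ Sum.inr ⟨0, hl⟩ → y + L * d ∈ X j) (hL : L ≤ 2 * R + 1)
    (h : ∀ e ≤ R, ∃ b ∈ X (Sum.inl ⟨0, hk⟩), ∃ b' ∈ X (Sum.inr ⟨0, hl⟩), b - b' = (e : ℕ) * d)
    (h' : ∀ e ≤ R, ∃ b ∈ X (Sum.inl ⟨0, hk⟩), ∃ b' ∈ X (Sum.inr ⟨0, hl⟩), b' - b = (e : ℕ) * d) :
    ∀ i < 2 * R + 1 + (k + l - 2) * L, Reach (sgn p k l) X univ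
      (k * y - l * (y + L * d) + L * d - R * d + i * d) := by
  classical
  have hne : (Sum.inl ⟨0, hk⟩ : Fin k ⊕ Fin l) ≠ Sum.inr ⟨0, hl⟩ := by simp
  have h2 := reach_progression (L := L) (t := univ \ {_, _}) disjoint_sdiff
    (fun j hj => hy j (by aesop) (by aesop)) (fun j hj => hyL j (by aesop) (by aesop)) hL (reach_pair_of_sub h h')
  rw [union_sdiff_of_subset (subset_univ _), card_compl_pair hne] at h2
  intro i hi
  convert h2 i hi using 1
  have hs : ∑ j : Fin k ⊕ Fin l, slotMin y d L j = k * y - l * (y + L * d) := by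
    rw [Fintype.sum_sum_type]
    simp [slotMin]
    ring
  rw [← sum_sdiff (subset_univ {Sum.inl ⟨0, hk⟩, Sum.inr ⟨0, hl⟩}), sum_pair hne] at hs
  simp only [slotMin, Sum.elim_inl, Sum.elim_inr] at hs ⊢
  linear_combination -hs

theorem ncard_cub {a : ZMod p} {t : ℕ} (ht : t < p) : (cub p n' a t).ncard = (t + 1) * p ^ n' := by
  classical
  have h1 : Ival a t = ((Finset.range (t + 1)).image (fun i : ℕ => a + (i : ZMod p)) :
      Finset (ZMod p)) := by
    ext x
    simp only [Ival, Set.mem_ofPred_eq, Finset.coe_image, Set.mem_image, Finset.mem_coe,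
      Finset.mem_range]
    constructor
    · rintro ⟨i, hi, rfl⟩
      exact ⟨i, by omega, rfl⟩
    · rintro ⟨i, hi, rfl⟩
      exact ⟨i, by omega, rfl⟩
  have h2 : cub p n' a t = Ival a t ×ˢ Set.univ := by
    ext x
    simp [cub]
  rw [h2, Set.ncard_prod, h1, Set.ncard_coe_finset, Finset.card_image_of_injOn, Finset.card_range,
    Set.ncard_univ]
  · simp
  · intro i hi j hj hij
    simp only [Finset.coe_range, Set.mem_Iio] at hi hj
    exact natCast_mul_inj one_ne_zero (y := a) (by omega) (by omega) (by simpa using hij)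

theorem isClassified_of_cub (H : Params k l m lam p) {a : ZMod p}
    (hA : A = cub p n' a (m - 1)) (hfree : SumFree p k l (Ival a (m - 1))) :
    IsClassified k l m lam p n' A := by
  have hceq := H.cast_eq
  have hH := H
  obtain ⟨hlk, hl, hkl, hlam, hp, hm⟩ := H
  have hqm : 5 * m ≤ (k + l) * m := Nat.mul_le_mul_right _ hkl
  have hAc : A.ncard = m * p ^ n' := by
    rw [hA, ncard_cub (by omega), Nat.sub_add_cancel (by omega)]
  have hm1 : ((m - 1 : ℕ) : ZMod p) = m - 1 := by
    rw [Nat.cast_sub (by omega), Nat.cast_one]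
  have hdiff : ∀ e ≤ m - 1, a + (e : ℕ) ∈ Ival a (m - 1) := fun e he => ⟨e, he, rfl⟩
  have ha0 : a ∈ Ival a (m - 1) := by simpa using hdiff 0 (by omega)
  have hr := reach_of_sub (k := k) (l := l) (X := fun _ => Ival a (m - 1)) (y := a) (d := 1)
    (L := m - 1) (R := m - 1) (by omega) (by omega) (fun _ _ _ => ha0)
    (fun _ _ _ => by simpa using hdiff (m - 1) le_rfl) (by omega)
    (fun e he => ⟨_, hdiff e he, _, ha0, by ring⟩)
    (fun e he => ⟨_, ha0, _, hdiff e he, by ring⟩)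
  set c : ZMod p := k * a - l * (a + (m - 1)) with hc
  have hv : ((-c).val : ZMod p) = -c := ZMod.natCast_zmod_val _
  have hlt := ZMod.val_lt (-c)
  have hN : 2 * (m - 1) + 1 + (k + l - 2) * (m - 1) = (k + l) * (m - 1) + 1 := by
    obtain ⟨q, hq⟩ : ∃ q, k + l = q + 2 := ⟨k + l - 2, by omega⟩
    rw [hq, Nat.add_sub_cancel]
    ring
  have hqm' : (k + l) * m = (k + l) * (m - 1) + (k + l) := by
    obtain ⟨M, rfl⟩ := Nat.exists_eq_add_of_le' (show 1 ≤ m by omega)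
    rw [Nat.add_sub_cancel]
    ring
  have hgt : (k + l) * (m - 1) < (-c).val := by
    by_contra! hcon
    apply hfree
    have := hr (-c).val (by omega)
    rw [hv] at this
    have h0 : (k * a - l * (a + (m - 1 : ℕ) * 1) + (m - 1 : ℕ) * 1 - (m - 1 : ℕ) * 1 + -c * 1 :
        ZMod p) = 0 := by
      rw [hc, hm1]
      ring
    rwa [h0] at this
  obtain ⟨r, hrv⟩ := Nat.exists_eq_add_of_lt hgt
  rw [hrv] at hv
  push_cast [hm1] at hv
  have hrle : r ≤ lam + k + l := by omega
  have hval : (l : ZMod p) * a - k * (a + m - 1) = r + 1 := by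
    linear_combination -hv - hc
  by_cases h1 : r + 1 ≤ l
  · refine Or.inr (Or.inl ⟨hAc, AddEquiv.refl _, a, Or.inl ⟨r, by omega, ?_⟩, by simp [hA]⟩)
    linear_combination hval
  by_cases h2 : r ≤ lam + l
  · refine isClassified_of_subset_Ival hH (y := a - 1) (j := r - l) (by omega) ?_ ?_
    · intro x hx
      rw [hA] at hx
      obtain ⟨i, hi, hx⟩ := hx
      refine ⟨i + 1, by omega, ?_⟩
      rw [hx]
      push_cast
      ring
    · rw [Nat.cast_sub (by omega)]
      linear_combination -hval
  by_cases h3 : r + 1 ≤ k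
  · refine Or.inr (Or.inl ⟨hAc, AddEquiv.refl _, a, Or.inr ⟨by omega, r - (lam + l + 1), by omega,
      ?_⟩, by simp [hA]⟩)
    rw [Nat.cast_sub (by omega)]
    push_cast
    linear_combination hval
  by_cases h4 : r ≤ lam + k
  · refine isClassified_of_subset_Ival hH (y := a) (j := r - k) (by omega) ?_ ?_
    · intro x hx
      rw [hA] at hx
      obtain ⟨i, hi, hx⟩ := hx
      exact ⟨i, by omega, hx⟩
    · rw [Nat.cast_sub (by omega)]
      linear_combination -hval
  · refine Or.inr (Or.inl ⟨hAc, AddEquiv.neg _, -(a + (m - 1 : ℕ)),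
      Or.inl ⟨lam + k + l - r, by omega, ?_⟩, ?_⟩)
    · rw [Nat.cast_sub hrle, hm1]
      push_cast
      linear_combination -hval - hceq
    · rw [hA]
      ext x
      constructor
      · rintro ⟨z, hz, rfl⟩
        exact mem_Ival_neg hz
      · intro hx
        refine ⟨-x, ?_, by simp⟩
        have := mem_Ival_neg (show x.1 ∈ _ from hx)
        simpa [cub] using this

end

section

open Finset

variable {k l m lam p n' : ℕ} [Fact p.Prime]

theorem mem_add_singleton_iff {W : Type*} [Add W] [DecidableEq W] {Z : Finset W} {c x : W} :
    x ∈ Z + {c} ↔ ∃ u ∈ Z, u + c = x := by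
  simp [Finset.mem_add]

theorem exists_submodule_of_card_add_self_le {W : Type*} [AddCommGroup W] [Module (ZMod p) W]
    [DecidableEq W] {Z : Finset W} {w₀ : W} (hw₀ : w₀ ∈ Z) (h : #(Z + Z) ≤ #Z) :
    ∃ V : Submodule (ZMod p) W, ∀ w, w ∈ Z ↔ w - w₀ ∈ V := by
  have hsub : Z + {w₀} ⊆ Z + Z := add_subset_add_left (by simpa)
  have heq : Z + {w₀} = Z + Z := eq_of_subset_of_card_le hsub (by simpa using h)
  have hadd : ∀ u v, u + w₀ ∈ Z → v + w₀ ∈ Z → u + v + w₀ ∈ Z := by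
    intro u v hu hv
    have h1 := add_mem_add hu hv
    rw [← heq] at h1
    obtain ⟨x, hx, hxe⟩ := mem_add_singleton_iff.1 h1
    have : x = u + v + w₀ := by
      apply add_right_cancel (b := w₀)
      rw [hxe]
      abel
    rwa [← this]
  have hnsmul : ∀ (n : ℕ) u, u + w₀ ∈ Z → n • u + w₀ ∈ Z := by
    intro n u hu
    induction n with
    | zero => simpa
    | succ n ih =>
      rw [succ_nsmul]
      exact hadd _ _ ih hu
  refine ⟨{ carrier := {u | u + w₀ ∈ Z}
            zero_mem' := by simpa
            add_mem' := fun hu hv => hadd _ _ hu hv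
            smul_mem' := fun c u hu => ?_ }, fun w => ?_⟩
  · have := hnsmul c.val u hu
    rwa [← Nat.cast_smul_eq_nsmul (ZMod p), ZMod.natCast_zmod_val] at this
  · rw [Submodule.mem_mk, AddSubmonoid.mem_mk]
    change _ ↔ w - w₀ + w₀ ∈ Z
    rw [sub_add_cancel]

theorem SumFree.exists_submodule (H : Params k l m lam p) {W : Type*} [AddCommGroup W]
    [Module (ZMod p) W] [Fintype W] {A : Set (ZMod p × W)} (hA : SumFree p k l A)
    (hAc : m * Fintype.card W ≤ A.ncard) (hodd : Odd (Fintype.card W))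
    (hS : #(laySupp A) ≤ m + 1) {y z : ZMod p} (hyz : (k : ZMod p) * z = l * y) (hne : y ≠ z)
    (hy : (lay A y).Nonempty) (hz : (lay A z).Nonempty) :
    l = 1 ∧ A.ncard = m * Fintype.card W ∧
      (∀ i ∈ laySupp A, i ≠ y → i ≠ z → lay A i = univ) ∧
      ∃ (w₀ : W) (V : Submodule (ZMod p) W), (∀ w, w ∈ lay A z ↔ w - w₀ ∈ V) ∧
        ∀ w, w ∈ lay A y ↔ w - (k : ZMod p) • w₀ ∉ V := by
  classical
  obtain ⟨hlk, hl, hkl, hlam, hp, hm⟩ := H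
  set P := Fintype.card W with hP
  have hrel : ∑ j, sgn p k l j * (Sum.elim (fun _ => z) (fun _ => y) : Fin k ⊕ Fin l → ZMod p) j
      = 0 := by
    rw [Fintype.sum_sum_type]
    simp [sgn, hyz]
  have hne' : ∀ j, (lay A ((Sum.elim (fun _ => z) (fun _ => y) : Fin k ⊕ Fin l → ZMod p) j)).Nonempty
      := by rintro (j | j) <;> simpa
  have hzy : #(lay A z) + #(lay A y) ≤ P := hA.card_lay_add_le hrel hne'
    (a := Sum.inl ⟨0, by omega⟩) (b := Sum.inr ⟨0, by omega⟩) (by simp)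
  have hzz : #(lay A z) + #(lay A z) ≤ P := hA.card_lay_add_le hrel hne'
    (a := Sum.inl ⟨0, by omega⟩) (b := Sum.inl ⟨1, by omega⟩) (by simp)
  have hsub : {y, z} ⊆ laySupp A := by
    intro i hi
    rw [mem_insert, mem_singleton] at hi
    rcases hi with rfl | rfl <;> rwa [mem_laySupp]
  have hsum := ncard_eq_sum_laySupp A
  rw [← sum_sdiff hsub, sum_pair hne] at hsum
  have hrc : #(laySupp A \ {y, z}) ≤ m - 1 := by
    rw [card_sdiff_of_subset hsub, card_pair hne]
    omega
  have hle := sum_le_card_nsmul (laySupp A \ {y, z}) (fun i => #(lay A i)) P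
    fun i _ => card_lay_le A i
  have hrc' := Nat.mul_le_mul_right P hrc
  have hmP : m * P = (m - 1) * P + P := by
    conv_lhs => rw [← Nat.sub_add_cancel (show 1 ≤ m by omega)]
    ring
  rw [smul_eq_mul] at hle
  have hsumP : #(lay A y) + #(lay A z) = P := by omega
  have hl1 : l = 1 := by
    by_contra hl1
    have hyy : #(lay A y) + #(lay A y) ≤ P := hA.card_lay_add_le hrel hne'
      (a := Sum.inr ⟨0, by omega⟩) (b := Sum.inr ⟨1, by omega⟩) (by simp)
    obtain ⟨r, hr⟩ := hodd
    omega
  have hnot : ∀ a ∈ lay A z, ∀ b ∈ lay A z, ∀ w ∈ lay A z, a + b + (k - 2) • w ∉ lay A y := by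
    intro a ha b hb w hw hx
    have := hA.not_reach_lay hrel
    obtain ⟨k, rfl⟩ := Nat.exists_eq_add_of_le' (show 2 ≤ k by omega)
    subst hl1
    apply this
    refine ⟨Sum.elim (Fin.cons a (Fin.cons b (fun _ => w))) (fun _ => a + b + k • w), ?_, ?_⟩
    · rintro (j | j) -
      · refine Fin.cases ?_ (fun j => ?_) j
        · simpa using ha
        · refine Fin.cases ?_ (fun j => ?_) j
          · simpa using hb
          · simpa using hw
      · simpa using hx
    · rw [Fintype.sum_sum_type]
      simp [sgn, Fin.sum_univ_succ]
      abel
  obtain ⟨w₀, hw₀⟩ := hz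
  have hZZ : #(lay A z + lay A z) ≤ #(lay A z) := by
    have h1 : #((lay A z + lay A z) + {(k - 2) • w₀}) ≤ #((lay A y)ᶜ) := by
      apply card_le_card
      intro x hx
      obtain ⟨u, hu, rfl⟩ := mem_add_singleton_iff.1 hx
      obtain ⟨a, ha, b, hb, rfl⟩ := mem_add.1 hu
      exact mem_compl.2 (hnot a ha b hb w₀ hw₀)
    rw [card_compl] at h1
    simp only [card_add_singleton] at h1
    omega
  obtain ⟨V, hV⟩ := exists_submodule_of_card_add_self_le (p := p) hw₀ hZZ
  refine ⟨hl1, by omega, ?_, w₀, V, hV, ?_⟩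
  · intro i hi hiy hiz
    have hi' : i ∈ laySupp A \ {y, z} := by simp [hi, hiy, hiz]
    have h1 := sum_erase_add (laySupp A \ {y, z}) (fun i => #(lay A i)) hi'
    have h2 := sum_le_card_nsmul ((laySupp A \ {y, z}).erase i) (fun i => #(lay A i)) P
      fun i _ => card_lay_le A i
    rw [card_erase_of_mem hi', smul_eq_mul] at h2
    have h3 : (#(laySupp A \ {y, z}) - 1) * P ≤ (m - 1 - 1) * P := Nat.mul_le_mul_right P (by omega)
    have h4 : (m - 1) * P = (m - 1 - 1) * P + P := by
      conv_lhs => rw [← Nat.sub_add_cancel (show 1 ≤ m - 1 by omega)]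
      ring
    apply eq_univ_of_card
    have := card_lay_le A i
    omega
  · have h1 : lay A y = (lay A z + {(k - 1) • w₀})ᶜ := by
      apply eq_of_subset_of_card_le
      · intro x hx
        rw [mem_compl]
        intro hx'
        obtain ⟨u, hu, rfl⟩ := mem_add_singleton_iff.1 hx'
        refine hnot u hu w₀ hw₀ w₀ hw₀ ?_
        rwa [show k - 1 = (k - 2) + 1 by omega, succ_nsmul', ← add_assoc] at hx
      · rw [card_compl, card_add_singleton]
        omega
    intro w
    rw [h1, mem_compl, mem_add_singleton_iff, not_iff_not, Nat.cast_smul_eq_nsmul,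
      show k = (k - 1) + 1 by omega, succ_nsmul', Nat.add_sub_cancel]
    constructor
    · intro hw
      obtain ⟨u, hu, rfl⟩ := hw
      rw [hV] at hu
      simpa [sub_add_eq_sub_sub_swap] using hu
    · intro hw
      refine ⟨w - (k - 1) • w₀, ?_, by simp⟩
      rw [hV]
      rwa [sub_add_eq_sub_sub_swap] at hw

/-- The shear `(t, w) ↦ (t, w - t • c)`. -/
def shear {R M : Type*} [Ring R] [AddCommGroup M] [Module R M] (c : M) : (R × M) ≃+ (R × M) where
  toFun x := (x.1, x.2 - x.1 • c)
  invFun x := (x.1, x.2 + x.1 • c)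
  left_inv x := by simp
  right_inv x := by simp
  map_add' x y := by
    ext1
    · simp
    · simp only [Prod.snd_add, Prod.fst_add, add_smul]
      abel

theorem isClassified_of_mul_eq (H : Params k l m lam p) {A : Set (ZMod p × (Fin n' → ZMod p))}
    (hA : SumFree p k l A) (hAc : m * Fintype.card (Fin n' → ZMod p) ≤ A.ncard) {y : ZMod p}
    (hS : #(laySupp A) ≤ m + 1) (hSy : ∀ t, t ∈ laySupp A ↔ t ∈ Ival y m)
    (hy : (k : ZMod p) * (y + m) = l * y) : IsClassified k l m lam p n' A := by
  have hm0 : (m : ZMod p) ≠ 0 := H.natCast_ne_zero (by have := H.hm; have := H.hlk; omega) le_rfl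
  have hP : Fintype.card (Fin n' → ZMod p) = p ^ n' := by simp
  have hpp : p.Prime := Fact.out
  have hm := H.hm
  have hlk := H.hlk
  have hp5 : 5 * m ≤ (k + l) * m := Nat.mul_le_mul_right _ H.hkl
  have hodd : Odd (Fintype.card (Fin n' → ZMod p)) := by
    rw [hP]
    exact (hpp.odd_of_ne_two (by have := H.hp; omega)).pow
  obtain ⟨hl1, hc, hfull, w₀, V, hVz, hVy⟩ := hA.exists_submodule H hAc hodd hS hy (by simpa using hm0)
    (mem_laySupp.1 ((hSy y).2 ⟨0, by simp⟩)) (mem_laySupp.1 ((hSy _).2 ⟨m, le_rfl, rfl⟩))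
  have hkl : (l : ZMod p) - k ≠ 0 := by
    have := H.natCast_ne_zero (c := k - l) (by omega) (by omega)
    rw [Nat.cast_sub hlk.le] at this
    rw [← neg_sub]
    exact neg_ne_zero.2 this
  have hya : y = type2a k l m p := by
    rw [type2a, eq_mul_inv_iff_mul_eq₀ hkl]
    linear_combination -hy
  have hz0 : y + m ≠ 0 := by
    intro h0
    rw [h0, hl1] at hy
    apply hm0
    linear_combination h0 + hy
  have hV : V ≠ ⊤ := by
    rintro rfl
    obtain ⟨w, hw⟩ := mem_laySupp.1 ((hSy y).2 ⟨0, by simp⟩)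
    rw [hVy] at hw
    simp at hw
  have hz1 : (y + m) • ((y + m)⁻¹ • w₀) = w₀ := smul_inv_smul₀ hz0 w₀
  have hy1 : y • ((y + m)⁻¹ • w₀) = (k : ZMod p) • w₀ := by
    have : y = k * (y + m) := by rw [hy, hl1]; simp
    conv_lhs => rw [this, mul_smul]
    congr 1
    conv_lhs => rw [← this]
    exact hz1
  refine Or.inr (Or.inr ⟨hl1, ?_, by rw [hc, hP], shear ((y + m)⁻¹ • w₀), V, hV, ?_⟩)
  · by_contra hn
    obtain rfl : n' = 0 := by omega
    apply hV
    rw [Submodule.eq_top_iff']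
    intro x
    rw [Subsingleton.elim x 0]
    exact V.zero_mem
  · rw [← hya]
    ext ⟨t, w⟩
    have hmem : (t, w) ∈ shear (R := ZMod p) ((y + m)⁻¹ • w₀) '' A ↔
        w + t • ((y + m)⁻¹ • w₀) ∈ lay A t := by
      rw [mem_lay]
      constructor
      · rintro ⟨x, hx, h⟩
        obtain rfl : (shear ((y + m)⁻¹ • w₀)).symm (t, w) = x := by
          rw [← h, AddEquiv.symm_apply_apply]
        exact hx
      · exact fun h => ⟨_, h, (shear ((y + m)⁻¹ • w₀)).apply_symm_apply (t, w)⟩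
    rw [hmem]
    simp only [Set.mem_union, Set.mem_prod, Set.mem_singleton_iff, Set.mem_sdiff, Set.mem_univ,
      true_and, and_true, SetLike.mem_coe]
    have hIy : y ∉ Ival (y + 1) (m - 2) := by
      rintro ⟨i, hi, h⟩
      refine H.natCast_ne_zero (c := i + 1) (by omega) (by omega) ?_
      push_cast
      linear_combination -h
    have hIz : y + m ∉ Ival (y + 1) (m - 2) := by
      rintro ⟨i, hi, h⟩
      refine H.natCast_ne_zero (c := m - (i + 1)) (by omega) (by omega) ?_
      rw [Nat.cast_sub (by omega)]
      push_cast
      linear_combination h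
    by_cases h1 : t = y
    · subst h1
      have h3 : t ≠ t + m := by simpa using hm0
      rw [hVy, hy1, add_sub_cancel_right]
      simp [hIy, h3]
    by_cases h2 : t = y + m
    · subst h2
      rw [hVz, hz1, add_sub_cancel_right]
      simp [hIz, hm0]
    simp only [h1, h2, false_and, false_or, or_false]
    constructor
    · intro hw
      obtain ⟨i, hi, rfl⟩ := (hSy t).1 (mem_laySupp.2 ⟨_, hw⟩)
      have hi0 : i ≠ 0 := by
        rintro rfl
        simp at h1
      have him : i ≠ m := by
        rintro rfl
        simp at h2
      refine ⟨i - 1, by omega, ?_⟩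
      rw [Nat.cast_sub (by omega)]
      push_cast
      ring
    · rintro ⟨i, hi, rfl⟩
      rw [hfull _ ((hSy _).2 ⟨i + 1, by omega, by push_cast; ring⟩) h1 h2]
      exact mem_univ _

end

section

open Finset

variable {k l m lam p n' : ℕ} [Fact p.Prime]

theorem mem_laySupp_neg_image {W : Type*} [AddCommGroup W] [Fintype W] {A : Set (ZMod p × W)}
    {t : ZMod p} : t ∈ laySupp ((AddEquiv.neg _) '' A) ↔ -t ∈ laySupp A := by
  simp only [mem_laySupp, Finset.Nonempty, mem_lay]
  constructor
  · rintro ⟨w, ⟨x, hx, h⟩⟩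
    refine ⟨-w, ?_⟩
    have : x = -(t, w) := by
      rw [← h]
      simp
    rwa [this] at hx
  · rintro ⟨w, hw⟩
    exact ⟨-w, _, hw, by simp⟩

theorem isClassified_of_mul_eq' (H : Params k l m lam p) {A : Set (ZMod p × (Fin n' → ZMod p))}
    (hA : SumFree p k l A) (hAc : m * Fintype.card (Fin n' → ZMod p) ≤ A.ncard) {y : ZMod p}
    (hS : #(laySupp A) ≤ m + 1) (hSy : ∀ t, t ∈ laySupp A ↔ t ∈ Ival y m)
    (hy : (k : ZMod p) * y = l * (y + m)) : IsClassified k l m lam p n' A := by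
  classical
  refine IsClassified.of_image (AddEquiv.neg _) ?_
  refine isClassified_of_mul_eq (y := -(y + m)) H (hA.image (LinearEquiv.neg (ZMod p))) ?_ ?_ ?_ ?_
  · rwa [Set.ncard_image_of_injective _ (AddEquiv.neg _).injective]
  · refine le_trans (card_le_card_of_injOn (fun t => -t) ?_ ?_) hS
    · intro t ht
      exact mem_laySupp_neg_image.1 ht
    · exact fun _ _ _ _ h => neg_injective h
  · intro t
    rw [mem_laySupp_neg_image, hSy]
    constructor
    · intro h
      simpa using mem_Ival_neg h
    · intro h
      simpa using mem_Ival_neg h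
  · linear_combination -hy

/-- The elements `i ≤ m` with `y + i ∈ B`. -/
noncomputable def slots (B : Finset (ZMod p)) (y : ZMod p) (m : ℕ) : Finset ℕ :=
  {i ∈ Finset.range (m + 1) | y + (i : ZMod p) ∈ B}

theorem card_slots (H : Params k l m lam p) {B : Finset (ZMod p)} {y : ZMod p}
    (hB : ∀ t ∈ B, t ∈ Ival y m) : #(slots B y m) = #B := by
  have hp5 : 5 * m ≤ (k + l) * m := Nat.mul_le_mul_right _ H.hkl
  have hp := H.hp
  refine card_bij (fun i _ => y + (i : ZMod p)) ?_ ?_ ?_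
  · intro i hi
    exact (mem_filter.1 hi).2
  · intro i hi j hj h
    have hi := mem_range.1 (mem_filter.1 hi).1
    have hj := mem_range.1 (mem_filter.1 hj).1
    exact natCast_mul_inj one_ne_zero (y := y) (by omega) (by omega) (by simpa using h)
  · intro t ht
    obtain ⟨i, hi, rfl⟩ := hB t ht
    exact ⟨i, mem_filter.2 ⟨mem_range.2 (by omega), ht⟩, rfl⟩

theorem ne_zero_of_core_of_mem (H : Params k l m lam p) {B : Set (ZMod p)} {B' : Finset (ZMod p)}
    (hB : (B' : Set (ZMod p)) ⊆ B) (hcore : IsCore p k l B B') (hm' : #B' = m) {y : ZMod p}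
    (hBy : ∀ t ∈ B', t ∈ Ival y m) (hy : y ∈ B') (hym : y + m ∈ B') :
    ∀ i ≤ (k + l) * m, (k : ZMod p) * y - l * (y + m) + (i : ℕ) ≠ 0 := by
  have hm := H.hm
  have hkl := H.hkl
  have hl := H.hl
  have hlk := H.hlk
  have hdiff : ∀ e ≤ m, ∃ i : ℕ, y + (i : ZMod p) ∈ B' ∧ y + (i + e : ℕ) ∈ B' := by
    intro e he
    rcases he.lt_or_eq with he | rfl
    · obtain ⟨s, hs, hs'⟩ := exists_add_mem_of_card (S := slots B' y m) (a := 0) (L := m) (m := m)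
        (fun i hi => by
          have := mem_range.1 (mem_filter.1 hi).1
          exact mem_Icc.2 ⟨by omega, by omega⟩)
        (by rw [card_slots H hBy, hm']) (by omega) (by omega) he
      exact ⟨s, (mem_filter.1 hs).2, (mem_filter.1 hs').2⟩
    · exact ⟨0, by simpa, by simpa⟩
  have hr := reach_of_sub (k := k) (l := l) (X := fun _ => (B' : Set (ZMod p))) (y := y) (d := 1)
    (L := m) (R := m) (by omega) hl (fun _ _ _ => hy) (fun _ _ _ => by simpa) (by omega)
    (fun e he => by
      obtain ⟨i, hi, hi'⟩ := hdiff e he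
      exact ⟨_, hi', _, hi, by push_cast; ring⟩)
    (fun e he => by
      obtain ⟨i, hi, hi'⟩ := hdiff e he
      exact ⟨_, hi, _, hi', by push_cast; ring⟩)
  intro i hi h0
  refine hcore (fun _ => B') (fun _ => hB) (Sum.inl ⟨0, by omega⟩) (Sum.inl ⟨1, by omega⟩) (by simp)
    Set.Subset.rfl Set.Subset.rfl ?_
  have hN : 2 * m + 1 + (k + l - 2) * m = (k + l) * m + 1 := by
    obtain ⟨q, hq⟩ : ∃ q, k + l = q + 2 := ⟨k + l - 2, by omega⟩
    rw [hq, Nat.add_sub_cancel]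
    ring
  have := hr i (by omega)
  have h1 : (k * y - l * (y + m * 1) + m * 1 - m * 1 + i * 1 : ZMod p) = 0 := by
    linear_combination h0
  rwa [h1] at this

theorem ne_zero_of_core_of_eq_Ival (H : Params k l m lam p) {B : Set (ZMod p)}
    {B' : Finset (ZMod p)}
    (hB : (B' : Set (ZMod p)) ⊆ B) (hcore : IsCore p k l B B') {y a : ZMod p}
    (ha : ∀ i : ℕ, i ≤ m - 1 → a + (i : ZMod p) ∈ B') (hy : y ∈ B) (hym : y + m ∈ B) :
    ∀ i < (k + l) * m, 1 ≤ i → (k : ZMod p) * y - l * (y + m) + (i : ℕ) ≠ 0 := by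
  have hm := H.hm
  have hkl := H.hkl
  have hl := H.hl
  have hlk := H.hlk
  have hr := reach_of_sub (k := k) (l := l) (X := fun j => if j = Sum.inl ⟨0, by omega⟩ ∨
    j = Sum.inr ⟨0, by omega⟩ then (B' : Set (ZMod p)) else B) (y := y) (d := 1)
    (L := m) (R := m - 1) (by omega) hl (fun j h1 h2 => by simpa [h1, h2])
    (fun j h1 h2 => by simpa [h1, h2]) (by omega)
    (fun e he => by
      simp only [true_or, or_true, if_true]
      exact ⟨_, ha e he, a, by simpa using ha 0 (by omega), by ring⟩)
    (fun e he => by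
      simp only [true_or, or_true, if_true]
      exact ⟨a, by simpa using ha 0 (by omega), _, ha e he, by ring⟩)
  intro i hi hi1 h0
  refine hcore _ (fun j => ?_) (Sum.inl ⟨0, by omega⟩) (Sum.inr ⟨0, by omega⟩) (by simp)
    ?_ ?_ (?_ : Reach _ (fun j => if j = Sum.inl ⟨0, by omega⟩ ∨
    j = Sum.inr ⟨0, by omega⟩ then (B' : Set (ZMod p)) else B) _ _)
  · split_ifs
    · exact hB
    · exact Set.Subset.rfl
  · simp
  · simp
  have hN : 2 * (m - 1) + 1 + (k + l - 2) * m + 1 = (k + l) * m := by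
    obtain ⟨q, hq⟩ : ∃ q, k + l = q + 2 := ⟨k + l - 2, by omega⟩
    obtain ⟨M, rfl⟩ := Nat.exists_eq_add_of_le' (show 1 ≤ m by omega)
    rw [hq, Nat.add_sub_cancel, Nat.add_sub_cancel]
    ring
  have := hr (i - 1) (by omega)
  have h1 : (k * y - l * (y + m * 1) + m * 1 - (m - 1 : ℕ) * 1 + (i - 1 : ℕ) * 1 : ZMod p) = 0 := by
    rw [Nat.cast_sub (by omega), Nat.cast_sub (by omega)]
    push_cast
    linear_combination h0
  rwa [h1] at this

theorem isClassified_of_core (H : Params k l m lam p) {A : Set (ZMod p × (Fin n' → ZMod p))}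
    (hA : SumFree p k l A) (hAc : m * Fintype.card (Fin n' → ZMod p) ≤ A.ncard) {y : ZMod p}
    (hS : #(laySupp A) ≤ m + 1) (hSy : ∀ t ∈ laySupp A, t ∈ Ival y m)
    {B' : Finset (ZMod p)} (hB : B' ⊆ laySupp A) (hm' : #B' = m)
    (hcore : IsCore p k l (laySupp A) B') : IsClassified k l m lam p n' A := by
  classical
  have hm := H.hm
  have hAy : ∀ x ∈ A, x.1 ∈ Ival y m := fun x hx =>
    hSy _ (mem_laySupp.2 ⟨x.2, mem_lay.2 hx⟩)
  have hBc : ((B' : Finset (ZMod p)) : Set (ZMod p)) ⊆ laySupp A := coe_subset.2 hB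
  have hBy : ∀ t ∈ B', t ∈ Ival y m := fun t ht => hSy t (hB ht)
  by_cases hends : y ∈ B' ∧ y + m ∈ B'
  · exact isClassified_of_ne_zero H hAy
      (ne_zero_of_core_of_mem H hBc hcore hm' hBy hends.1 hends.2)
  have hsl := card_slots H hBy
  rw [hm'] at hsl
  have hB'a : ∃ a, ∀ t, t ∈ B' ↔ t ∈ Ival a (m - 1) := by
    rw [Classical.not_and_iff_not_or_not] at hends
    have key : ∀ S : Finset ℕ, #S = m → slots B' y m ⊆ S → slots B' y m = S := fun S hS hsub =>
      eq_of_subset_of_card_le hsub (by omega)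
    rcases hends with h | h
    · have hk := key (Icc 1 m) (by simp) (by
        intro i hi
        obtain ⟨hi1, hi2⟩ := mem_filter.1 hi
        have := mem_range.1 hi1
        rcases Nat.eq_zero_or_pos i with rfl | h0
        · simp [h] at hi2
        · exact mem_Icc.2 ⟨h0, by omega⟩)
      refine ⟨y + 1, fun t => ⟨fun ht => ?_, ?_⟩⟩
      · obtain ⟨i, hi, rfl⟩ := hBy t ht
        have : i ∈ slots B' y m := mem_filter.2 ⟨mem_range.2 (by omega), ht⟩
        rw [hk, mem_Icc] at this
        refine ⟨i - 1, by omega, ?_⟩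
        rw [Nat.cast_sub (by omega)]
        push_cast
        ring
      · rintro ⟨i, hi, rfl⟩
        have : i + 1 ∈ slots B' y m := by
          rw [hk, mem_Icc]
          omega
        have := (mem_filter.1 this).2
        push_cast at this
        rwa [add_assoc, add_comm (1 : ZMod p)]
    · have hk := key (range m) (by simp) (by
        intro i hi
        obtain ⟨hi1, hi2⟩ := mem_filter.1 hi
        have := mem_range.1 hi1
        rcases eq_or_ne i m with rfl | h0
        · simp [h] at hi2
        · exact mem_range.2 (by omega))
      refine ⟨y, fun t => ⟨fun ht => ?_, ?_⟩⟩
      · obtain ⟨i, hi, rfl⟩ := hBy t ht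
        have : i ∈ slots B' y m := mem_filter.2 ⟨mem_range.2 (by omega), ht⟩
        rw [hk, mem_range] at this
        exact ⟨i, by omega, rfl⟩
      · rintro ⟨i, hi, rfl⟩
        have : i ∈ slots B' y m := by
          rw [hk, mem_range]
          omega
        exact (mem_filter.1 this).2
  obtain ⟨a, ha⟩ := hB'a
  have hset : (B' : Set (ZMod p)) = Ival a (m - 1) := Set.ext ha
  by_cases hlt : #(laySupp A) = m
  · have heq : B' = laySupp A := eq_of_subset_of_card_le hB (by omega)
    refine isClassified_of_cub H (a := a) ?_ ?_
    · refine Set.eq_of_subset_of_ncard_le ?_ ?_ (Set.toFinite _)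
      · intro x hx
        exact (ha _).1 (heq ▸ mem_laySupp.2 ⟨x.2, mem_lay.2 hx⟩)
      · have hp5 : 5 * m ≤ (k + l) * m := Nat.mul_le_mul_right _ H.hkl
        have hp := H.hp
        rw [ncard_cub (by omega), Nat.sub_add_cancel (by omega)]
        simpa using hAc
    · rw [← hset]
      exact hcore (fun _ => B') (fun _ => hBc) (Sum.inl ⟨0, by have := H.hlk; omega⟩)
        (Sum.inr ⟨0, H.hl⟩) (by simp) Set.Subset.rfl Set.Subset.rfl
  have hge : m + 1 ≤ #(laySupp A) := by
    have := card_le_card hB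
    omega
  have hfull : ∀ i ≤ m, y + (i : ℕ) ∈ laySupp A := by
    have h1 : slots (laySupp A) y m = range (m + 1) := by
      refine eq_of_subset_of_card_le (filter_subset _ _) ?_
      rw [card_slots H hSy, card_range]
      exact hge
    intro i hi
    have : i ∈ slots (laySupp A) y m := by
      rw [h1, mem_range]
      omega
    exact (mem_filter.1 this).2
  have hiff : ∀ t, t ∈ laySupp A ↔ t ∈ Ival y m := fun t =>
    ⟨hSy t, by rintro ⟨i, hi, rfl⟩; exact hfull i hi⟩
  have hne := ne_zero_of_core_of_eq_Ival H hBc hcore (y := y) (a := a)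
    (fun i hi => (ha _).2 ⟨i, hi, rfl⟩) (by simpa using hfull 0 (by omega)) (hfull m le_rfl)
  by_cases h1 : (k : ZMod p) * y = l * (y + m)
  · exact isClassified_of_mul_eq' H hA hAc hS hiff h1
  by_cases h2 : (k : ZMod p) * (y + m) = l * y
  · exact isClassified_of_mul_eq H hA hAc hS hiff h2
  refine isClassified_of_ne_zero H hAy fun i hi h0 => ?_
  rcases Nat.eq_zero_or_pos i with rfl | hi0
  · apply h1
    push_cast at h0
    linear_combination h0
  rcases hi.lt_or_eq with hi | rfl
  · exact hne i hi hi0 h0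
  · apply h2
    push_cast at h0
    linear_combination h0

end

section

open Finset

variable {k l m lam p n : ℕ} [Fact p.Prime]

theorem sum_stdAddChar_dotProduct_of_ne_zero {v : Fin n → ZMod p} (hv : v ≠ 0) :
    ∑ y : Fin n → ZMod p, ZMod.stdAddChar (v ⬝ᵥ y) = 0 := by
  set χ : AddChar (Fin n → ZMod p) ℂ := ZMod.stdAddChar.compAddMonoidHom
    (AddMonoidHom.mk' (fun y => v ⬝ᵥ y) (dotProduct_add v)) with hχ
  refine AddChar.sum_eq_zero_of_ne_one (ψ := χ) fun h => ?_
  obtain ⟨i, hi⟩ := Function.ne_iff.1 hv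
  have h1 : ZMod.stdAddChar (v ⬝ᵥ Pi.single i (v i)⁻¹) = 1 :=
    congrArg (fun c : AddChar (Fin n → ZMod p) ℂ => c (Pi.single i (v i)⁻¹)) h
  rw [dotProduct_single, mul_inv_cancel₀ hi, ← AddChar.map_zero_eq_one (ZMod.stdAddChar (N := p))]
    at h1
  exact one_ne_zero (ZMod.injective_stdAddChar h1)

theorem addChar_sum {ι : Type*} (ψ : AddChar (ZMod p) ℂ) (s : Finset ι) (f : ι → ZMod p) :
    ψ (∑ j ∈ s, f j) = ∏ j ∈ s, ψ (f j) := by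
  classical
  induction s using Finset.induction_on with
  | empty => simp
  | insert a s ha ih => rw [sum_insert ha, prod_insert ha, AddChar.map_add_eq_mul, ih]

/-- The Fourier coefficient of the indicator of `A` at `y`. -/
noncomputable def fcoeff (A : Finset (Fin n → ZMod p)) (y : Fin n → ZMod p) : ℂ :=
  ∑ x ∈ A, ZMod.stdAddChar (x ⬝ᵥ y)

theorem fcoeff_zero (A : Finset (Fin n → ZMod p)) : fcoeff A 0 = #A := by
  simp [fcoeff]

theorem sum_norm_fcoeff_sq (A : Finset (Fin n → ZMod p)) :
    ∑ y, ‖fcoeff A y‖ ^ 2 = (p : ℝ) ^ n * #A := by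
  classical
  have h1 : ∀ y, ((‖fcoeff A y‖ ^ 2 : ℝ) : ℂ) =
      ∑ a ∈ A, ∑ b ∈ A, ZMod.stdAddChar ((a - b) ⬝ᵥ y) := by
    intro y
    rw [Complex.ofReal_pow, ← Complex.mul_conj', fcoeff, map_sum, sum_mul_sum]
    refine sum_congr rfl fun a _ => sum_congr rfl fun b _ => ?_
    rw [← AddChar.map_neg_eq_conj, ← AddChar.map_add_eq_mul, sub_dotProduct, sub_eq_add_neg]
  have h2 : ((∑ y, ‖fcoeff A y‖ ^ 2 : ℝ) : ℂ) = (p : ℂ) ^ n * #A := by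
    rw [Complex.ofReal_sum, sum_congr rfl fun y _ => h1 y, sum_comm]
    have h3 : ∀ a ∈ A, ∑ y : Fin n → ZMod p, ∑ b ∈ A, ZMod.stdAddChar ((a - b) ⬝ᵥ y) =
        (p : ℂ) ^ n := by
      intro a ha
      rw [sum_comm, sum_eq_single a]
      · simp
      · intro b _ hb
        exact sum_stdAddChar_dotProduct_of_ne_zero (sub_ne_zero.2 hb.symm)
      · exact fun h => absurd ha h
    rw [sum_congr rfl h3, sum_const, nsmul_eq_mul, mul_comm]
  exact_mod_cast h2

theorem SumFree.card_pow_le (A : Finset (Fin n → ZMod p))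
    (hA : SumFree p k l (A : Set (Fin n → ZMod p))) :
    (#A : ℝ) ^ (k + l) ≤ ∑ y ∈ univ.erase 0, ‖fcoeff A y‖ ^ (k + l) := by
  classical
  set G : Fin k ⊕ Fin l → (Fin n → ZMod p) → ℂ :=
    fun j y => ∑ x ∈ A, ZMod.stdAddChar (sgn p k l j * (x ⬝ᵥ y)) with hG
  have hGn : ∀ j y, ‖G j y‖ = ‖fcoeff A y‖ := by
    rintro (j | j) y
    · simp [hG, sgn, fcoeff]
    · rw [fcoeff, ← RCLike.norm_conj (∑ x ∈ A, _), map_sum]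
      simp [sgn, AddChar.map_neg_eq_conj]
  have hsum : ∑ y, ∏ j, G j y = 0 := by
    simp only [hG, prod_univ_sum]
    rw [sum_comm]
    refine sum_eq_zero fun g hg => ?_
    have hne : ∑ j, sgn p k l j • g j ≠ 0 := by
      intro h0
      exact hA ⟨g, fun j _ => Fintype.mem_piFinset.1 hg j, h0⟩
    rw [← sum_stdAddChar_dotProduct_of_ne_zero hne]
    refine sum_congr rfl fun y _ => ?_
    rw [sum_dotProduct, addChar_sum]
    simp only [smul_dotProduct, smul_eq_mul]
  rw [← sum_erase_add _ _ (mem_univ 0)] at hsum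
  have h0 : ‖∏ j, G j 0‖ = (#A : ℝ) ^ (k + l) := by
    rw [norm_prod, prod_congr rfl fun j _ => hGn j 0]
    simp [fcoeff_zero]
  rw [← h0, eq_neg_of_add_eq_zero_right hsum, norm_neg]
  refine (norm_sum_le _ _).trans (sum_le_sum fun y _ => ?_)
  rw [norm_prod, prod_congr rfl fun j _ => hGn j y]
  simp

theorem SumFree.exists_fcoeff (H : Params k l m lam p) (hn : 1 ≤ n) (A : Finset (Fin n → ZMod p))
    (hA : SumFree p k l (A : Set (Fin n → ZMod p))) (hAc : m * p ^ (n - 1) ≤ #A) :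
    ∃ y ≠ 0, (2 * p ^ (n - 1) : ℝ) < ‖fcoeff A y‖ := by
  by_contra! hcon
  have h1 := hA.card_pow_le
  obtain ⟨hlk, hl, hkl, hlam, hp, hm⟩ := H
  obtain ⟨q, hq⟩ : ∃ q, k + l = q + 2 := ⟨k + l - 2, by omega⟩
  rw [hq] at h1
  set P : ℝ := (p : ℝ) ^ (n - 1) with hP
  have hp0 : (0 : ℝ) < p := by exact_mod_cast (Fact.out : p.Prime).pos
  have hP0 : 0 < P := by positivity
  have hpn : (p : ℝ) ^ n = p * P := by
    rw [hP, ← pow_succ', Nat.sub_add_cancel hn]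
  have h2 : ∑ y ∈ univ.erase 0, ‖fcoeff A y‖ ^ (q + 2) ≤
      (2 * P) ^ q * ((p : ℝ) ^ n * #A) := by
    rw [← sum_norm_fcoeff_sq, mul_sum]
    refine (sum_le_sum (g := fun y => (2 * P) ^ q * ‖fcoeff A y‖ ^ 2) fun y hy => ?_).trans
      (sum_le_sum_of_subset_of_nonneg (erase_subset _ _) fun y _ _ => by positivity)
    rw [pow_add]
    gcongr
    exact hcon y (ne_of_mem_erase hy)
  have hAr : (m : ℝ) * P ≤ #A := by rw [hP]; exact_mod_cast hAc
  have hm0 : (0 : ℝ) < m := by exact_mod_cast (show 0 < m by omega)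
  have hA0 : (0 : ℝ) < #A := lt_of_lt_of_le (by positivity) hAr
  have h3 : (#A : ℝ) ^ (q + 1) ≤ (2 * P) ^ q * (p * P) := by
    refine le_of_mul_le_mul_right ?_ hA0
    rw [← pow_succ]
    refine (h1.trans h2).trans_eq ?_
    rw [hpn]
    ring
  have h4 : ((m : ℝ) ^ (q + 1)) * P ^ (q + 1) ≤ (2 ^ q * p) * P ^ (q + 1) := by
    rw [← mul_pow]
    refine (pow_le_pow_left₀ (by positivity) hAr _).trans (h3.trans_eq ?_)
    ring
  have h5 : (m : ℝ) ^ (q + 1) ≤ 2 ^ q * p := le_of_mul_le_mul_right h4 (by positivity)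
  have h6 : m ^ (q + 1) ≤ 2 ^ q * p := by exact_mod_cast h5
  have h7 : p ≤ (q + 3) * m := by
    rw [hp, hq]
    nlinarith
  have h8 : q + 3 < 5 ^ q := by
    have : ∀ r, r + 3 + 3 < 5 ^ (r + 3) := by
      intro r
      induction r with
      | zero => norm_num
      | succ r ih =>
        rw [show r + 1 + 3 = r + 3 + 1 by ring, pow_succ]
        omega
    obtain ⟨r, rfl⟩ := Nat.exists_eq_add_of_le' (show 3 ≤ q by omega)
    exact this r
  have h9 : m ^ q ≤ 2 ^ q * (q + 3) := by
    refine Nat.le_of_mul_le_mul_right ?_ (show 0 < m by omega)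
    rw [← pow_succ]
    calc m ^ (q + 1) ≤ 2 ^ q * p := h6
      _ ≤ 2 ^ q * ((q + 3) * m) := Nat.mul_le_mul_left _ h7
      _ = _ := by ring
  have h10 : 2 ^ q * 5 ^ q ≤ m ^ q := by
    rw [← mul_pow]
    exact Nat.pow_le_pow_left (by omega) q
  have h11 : 2 ^ q * (q + 3) < 2 ^ q * 5 ^ q := Nat.mul_lt_mul_of_pos_left h8 (by positivity)
  omega

theorem card_lay_image {W : Type*} [AddCommGroup W] [Module (ZMod p) W] [Fintype W]
    (A : Finset (Fin n → ZMod p)) (f : (Fin n → ZMod p) ≃ₗ[ZMod p] ZMod p × W) (i : ZMod p) :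
    #(lay (f '' (A : Set (Fin n → ZMod p))) i) = #{x ∈ A | (f x).1 = i} := by
  classical
  refine card_bij (fun w _ => f.symm (i, w)) ?_ ?_ ?_
  · intro w hw
    obtain ⟨x, hx, h⟩ := mem_lay.1 hw
    have hx' : x = f.symm (i, w) := by rw [← h, LinearEquiv.symm_apply_apply]
    refine mem_filter.2 ⟨hx' ▸ hx, by simp⟩
  · intro w _ w' _ h
    simpa using h
  · intro x hx
    obtain ⟨hxA, hxi⟩ := mem_filter.1 hx
    subst hxi
    exact ⟨(f x).2, mem_lay.2 ⟨x, hxA, rfl⟩, by simp⟩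

theorem add_card_le_of_lt_norm_fcoeff {W : Type*} [AddCommGroup W] [Module (ZMod p) W] [Fintype W]
    (A : Finset (Fin n → ZMod p)) (f : (Fin n → ZMod p) ≃ₗ[ZMod p] ZMod p × W)
    {y : Fin n → ZMod p} (hf : ∀ x, (f x).1 = x ⬝ᵥ y) {r : ℕ} (hr : (r : ℝ) < ‖fcoeff A y‖) (M : ℕ)
    (hM : ∀ i, #(lay (f '' (A : Set (Fin n → ZMod p))) i) ≤ M) : r + #A ≤ p * M := by
  classical
  simp only [card_lay_image, hf] at hM
  have h1 : fcoeff A y = ∑ i : ZMod p, (#{x ∈ A | x ⬝ᵥ y = i} : ℂ) * ZMod.stdAddChar i := by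
    rw [fcoeff, ← sum_fiberwise A (fun x => x ⬝ᵥ y)]
    refine sum_congr rfl fun i _ => ?_
    rw [← nsmul_eq_mul, ← sum_const]
    exact sum_congr rfl fun x hx => by rw [(mem_filter.1 hx).2]
  have h2 : ∑ i : ZMod p, (M : ℂ) * ZMod.stdAddChar i = 0 := by
    rw [← mul_sum, AddChar.sum_eq_zero_of_ne_one, mul_zero]
    intro h
    have := congrArg (fun c : AddChar (ZMod p) ℂ => c 1) h
    simp only [AddChar.one_apply] at this
    rw [← AddChar.map_zero_eq_one (ZMod.stdAddChar (N := p))] at this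
    exact one_ne_zero (ZMod.injective_stdAddChar this)
  have h3 : ‖fcoeff A y‖ ≤ ∑ i : ZMod p, ((M : ℝ) - #{x ∈ A | x ⬝ᵥ y = i}) := by
    rw [← norm_neg, ← zero_sub, ← h2, h1, ← sum_sub_distrib]
    refine (norm_sum_le _ _).trans (sum_le_sum fun i _ => ?_)
    rw [← sub_mul, norm_mul, AddChar.norm_apply, mul_one]
    have : ((M : ℂ) - #{x ∈ A | x ⬝ᵥ y = i}) = (((M - #{x ∈ A | x ⬝ᵥ y = i} : ℕ)) : ℂ) := by
      rw [Nat.cast_sub (hM i)]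
    rw [this, Complex.norm_natCast, Nat.cast_sub (hM i)]
  have h4 : (#A : ℝ) = ∑ i : ZMod p, (#{x ∈ A | x ⬝ᵥ y = i} : ℝ) := by
    rw [← Nat.cast_sum, ← card_eq_sum_card_fiberwise (fun x _ => mem_univ _)]
  rw [sum_sub_distrib, ← h4, sum_const, card_univ, ZMod.card, nsmul_eq_mul] at h3
  have h5 : (r : ℝ) + #A ≤ p * M := by linarith
  exact_mod_cast h5

theorem exists_linearEquiv_fst_eq_dotProduct {y : Fin n → ZMod p} (hy : y ≠ 0) :
    ∃ f : (Fin n → ZMod p) ≃ₗ[ZMod p] ZMod p × (Fin (n - 1) → ZMod p), ∀ x, (f x).1 = x ⬝ᵥ y := by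
  let φ : Module.Dual (ZMod p) (Fin n → ZMod p) :=
    { toFun := fun x => x ⬝ᵥ y
      map_add' := fun a b => add_dotProduct a b y
      map_smul' := fun c a => smul_dotProduct c a y }
  have hφ : φ ≠ 0 := by
    obtain ⟨i, hi⟩ := Function.ne_iff.1 hy
    intro h
    apply hi
    have := LinearMap.congr_fun h (Pi.single i 1)
    simpa [φ] using this
  have hdim := Module.Dual.finrank_ker_add_one_of_ne_zero hφ
  rw [Module.finrank_fin_fun] at hdim
  obtain ⟨Q, hQ⟩ := Submodule.exists_isCompl (LinearMap.ker φ)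
  let e₁ := LinearMap.equivProdOfSurjectiveOfIsCompl φ
    (Submodule.projectionOnto (LinearMap.ker φ) Q hQ)
    (LinearMap.range_eq_top.2 (LinearMap.surjective hφ)) (Submodule.range_projectionOnto hQ)
    (by rwa [Submodule.ker_projectionOnto])
  let e₂ : LinearMap.ker φ ≃ₗ[ZMod p] (Fin (n - 1) → ZMod p) :=
    LinearEquiv.ofFinrankEq _ _ (by rw [Module.finrank_fin_fun]; omega)
  refine ⟨e₁.trans (LinearEquiv.prodCongr (LinearEquiv.refl _ _) e₂), fun x => ?_⟩
  simp [e₁, φ]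

end

section

open Finset

theorem sum_mem_itSum {G : Type*} [AddCommMonoid G] {A : Set G} {h : ℕ} {f : Fin h → G}
    (hf : ∀ i, f i ∈ A) : ∑ i, f i ∈ itSum h A := by
  induction h with
  | zero => simp [itSum]
  | succ h ih =>
    rw [Fin.sum_univ_castSucc]
    exact Set.add_mem_add (ih fun i => hf i.castSucc) (hf _)

theorem KLFree.sumFree {p k l : ℕ} {M : Type*} [AddCommGroup M] [Module (ZMod p) M] {A : Set M}
    (h : KLFree k l A) : SumFree p k l A := by
  rintro ⟨g, hg, h0⟩
  rw [Fintype.sum_sum_type] at h0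
  simp only [sgn, Sum.elim_inl, Sum.elim_inr, one_smul, neg_smul, sum_neg_distrib] at h0
  have h1 := sum_mem_itSum (f := fun i => g (Sum.inl i)) fun i => hg _ (mem_univ _)
  have h2 := sum_mem_itSum (f := fun i => g (Sum.inr i)) fun i => hg _ (mem_univ _)
  rw [← sub_eq_add_neg, sub_eq_zero] at h0
  have : ∑ i, g (Sum.inl i) ∈ itSum k A ∩ itSum l A := ⟨h1, h0 ▸ h2⟩
  rw [h] at this
  exact this

theorem add_five_le_of_mul_rpow_le {q lam m : ℕ} (hq : 1 ≤ q) {e : ℝ} (he : 0 ≤ e)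
    (h : ((q + lam + 4 : ℕ) : ℝ) * (1 + 1 / (q : ℝ)) * (q : ℝ) ^ e ≤ (m : ℝ)) :
    q + lam + 5 ≤ m := by
  have hq1 : (1 : ℝ) ≤ q := by exact_mod_cast hq
  have h1 : (1 : ℝ) ≤ (q : ℝ) ^ e := Real.one_le_rpow hq1 he
  have h2 : ((q + lam + 5 : ℕ) : ℝ) ≤ ((q + lam + 4 : ℕ) : ℝ) * (1 + 1 / (q : ℝ)) := by
    push_cast
    have h3 : (1 : ℝ) ≤ ((q : ℝ) + lam + 4) * (1 / q) := by
      rw [mul_one_div, le_div_iff₀ (by linarith)]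
      have : (0 : ℝ) ≤ lam := by positivity
      linarith
    linarith
  have h4 : ((q + lam + 5 : ℕ) : ℝ) ≤ m := by
    refine le_trans h2 (le_trans ?_ h)
    exact le_mul_of_one_le_right (by positivity) h1
  exact_mod_cast h4

variable {k l m lam p n' : ℕ} [Fact p.Prime]

theorem mem_laySupp_prodCongr_image {W : Type*} [AddCommGroup W] [Module (ZMod p) W] [Fintype W]
    {A : Set (ZMod p × W)} (e : ZMod p ≃ₗ[ZMod p] ZMod p) {t : ZMod p} :
    t ∈ laySupp ((LinearEquiv.prodCongr e (LinearEquiv.refl (ZMod p) W)) '' A) ↔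
      e.symm t ∈ laySupp A := by
  simp only [mem_laySupp, Finset.Nonempty, mem_lay]
  constructor
  · rintro ⟨w, x, hx, h⟩
    have h1 := congrArg Prod.fst h
    have h2 := congrArg Prod.snd h
    simp only [LinearEquiv.prodCongr_apply, LinearEquiv.refl_apply] at h1 h2
    exact ⟨w, by rwa [← h1, ← h2, LinearEquiv.symm_apply_apply]⟩
  · rintro ⟨w, hw⟩
    exact ⟨w, _, hw, by simp⟩

theorem card_fun_eq_one_or : Fintype.card (Fin n' → ZMod p) = 1 ∨
    ∃ N, Fintype.card (Fin n' → ZMod p) = p * N ∧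
      ∀ H : AddSubgroup (Fin n' → ZMod p), H ≠ ⊤ → Nat.card H ≤ N := by
  rcases n' with _ | n'
  · exact Or.inl (by simp)
  refine Or.inr ⟨p ^ n', by simp [pow_succ'], fun H hH => ?_⟩
  have hpp : p.Prime := Fact.out
  have hcard : Nat.card (Fin (n' + 1) → ZMod p) = p ^ (n' + 1) := by simp
  have hdvd := H.card_addSubgroup_dvd_card
  rw [hcard, Nat.dvd_prime_pow hpp] at hdvd
  obtain ⟨j, hj, hj'⟩ := hdvd
  rw [hj']
  refine Nat.pow_le_pow_right hpp.pos ?_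
  by_contra! hlt
  apply hH
  refine AddSubgroup.eq_top_of_card_eq _ ?_
  rw [hj', hcard]
  congr 1
  omega

theorem SumFree.exists_isClassified {n : ℕ} (H : Params k l m lam p) (hn : 1 ≤ n) {τ : ℝ}
    (hfeas : Feasible (1 / (k + l : ℝ)) τ) (hτ : 5 ≤ τ * m) {A : Set (Fin n → ZMod p)}
    (hA : SumFree p k l A) (hAc : m * p ^ (n - 1) ≤ A.ncard) :
    ∃ f : (Fin n → ZMod p) ≃+ ZMod p × (Fin (n - 1) → ZMod p),
      IsClassified k l m lam p (n - 1) (f '' A) := by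
  classical
  have hP : Fintype.card (Fin (n - 1) → ZMod p) = p ^ (n - 1) := by simp
  have hpp : p.Prime := Fact.out
  have hp := H.hp
  have hm := H.hm
  have hkl := H.hkl
  have hp5 : 5 * m ≤ (k + l) * m := Nat.mul_le_mul_right _ H.hkl
  have hodd : Odd (Fintype.card (Fin (n - 1) → ZMod p)) := by
    rw [hP]
    exact (hpp.odd_of_ne_two (by omega)).pow
  obtain ⟨A, rfl⟩ : ∃ B : Finset (Fin n → ZMod p), A = B := ⟨A.toFinite.toFinset, by simp⟩
  rw [Set.ncard_coe_finset] at hAc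
  obtain ⟨y, hy, hFy⟩ := hA.exists_fcoeff H hn A hAc
  obtain ⟨f, hf⟩ := exists_linearEquiv_fst_eq_dotProduct hy
  have hA1 := hA.image f
  have hcard1 : (f '' (A : Set (Fin n → ZMod p))).ncard = #A := by
    rw [Set.ncard_image_of_injective _ f.injective, Set.ncard_coe_finset]
  obtain ⟨i, hi⟩ := exists_half_lt_card_lay H hA1 (by rwa [hcard1, hP])
    (fun M hM => by
      rw [hcard1, hP]
      exact add_card_le_of_lt_norm_fcoeff A f hf (by push_cast; exact hFy) M hM)
    card_fun_eq_one_or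
  have hS1 := card_laySupp_le H hA1 (by rwa [hcard1, hP]) ⟨i, hi⟩
  obtain ⟨B₁, hB₁, hB₁m, hcore₁⟩ := hA1.exists_core (by rwa [hcard1, hP]) hodd hS1 (by omega)
  obtain ⟨y₀, d, hd, hyd⟩ := hcore₁.exists_progression_of_card_le H hfeas hτ hB₁ hB₁m hS1
  let e : ZMod p ≃ₗ[ZMod p] ZMod p := LinearEquiv.smulOfNeZero (ZMod p) (ZMod p) d⁻¹ (inv_ne_zero hd)
  have he : ∀ t, e.symm t = d * t := fun t => by
    rw [LinearEquiv.symm_apply_eq]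
    simp [e, hd]
  let F := LinearEquiv.prodCongr e (LinearEquiv.refl (ZMod p) (Fin (n - 1) → ZMod p))
  have hA2 := hA1.image F
  have hcard2 : (F '' (f '' (A : Set (Fin n → ZMod p)))).ncard = #A := by
    rw [Set.ncard_image_of_injective _ F.injective, hcard1]
  have hS2 : #(laySupp (F '' (f '' (A : Set (Fin n → ZMod p))))) ≤ m + 1 := by
    refine le_trans (card_le_card_of_injOn e.symm ?_ e.symm.injective.injOn) hS1
    exact fun t ht => (mem_laySupp_prodCongr_image e).1 ht
  obtain ⟨B₂, hB₂, hB₂m, hcore₂⟩ := hA2.exists_core (by rwa [hcard2, hP]) hodd hS2 (by omega)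
  refine ⟨(f.trans F).toAddEquiv, ?_⟩
  have him : (f.trans F).toAddEquiv '' (A : Set (Fin n → ZMod p)) = F '' (f '' A) := by
    rw [Set.image_image]
    rfl
  rw [him]
  refine isClassified_of_core H hA2 (by rwa [hcard2, hP]) (y := d⁻¹ * y₀) hS2 ?_ hB₂ hB₂m hcore₂
  intro t ht
  have ht := (mem_laySupp_prodCongr_image e).1 ht
  obtain ⟨i, hi, hti⟩ := hyd _ ht
  refine ⟨i, hi, ?_⟩
  rw [he] at hti
  apply mul_left_cancel₀ hd
  rw [hti, mul_add, mul_inv_cancel_left₀ hd]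
  ring

end

/-- (Hilton–Milner type theorem, `λ ≤ k+ℓ-5`.) For large `m`,
every nontrivial `(k,ℓ)`-sum-free set `A ⊆ F_p^n` with `|A| ≥ m·p^(n-1)` is normal. -/
theorem stmt2 (k l n m lam p : ℕ) (τ : ℝ)
    (hlk : l < k) (hl : 1 ≤ l) (hkl : 5 ≤ k + l) (hlam : lam ≤ k + l - 5)
    (hp : p = (k + l) * m + 2 + lam) (hpp : p.Prime) (hn : 1 ≤ n)
    (hτ0 : 0 < τ) (hτ1 : τ ≤ 1) (hfeas : Feasible (1 / (k + l : ℝ)) τ)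
    (hm1 : 5 / τ ≤ (m : ℝ))
    (hm2 : ((k + l + lam + 4 : ℕ) : ℝ) * (1 + 1 / (k + l : ℝ)) *
        ((k + l : ℕ) : ℝ) ^ ((1 : ℝ) / ((k + l - 2 : ℕ) : ℝ)) ≤ (m : ℝ))
    (A : Set (Fin n → ZMod p)) (hA : A.Nonempty) (hfree : KLFree k l A)
    (hnt : ¬ IsTrivialKL k l m lam p n A) (hcard : m * p ^ (n - 1) ≤ A.ncard) :
    IsNormalKL k l m lam p n A := by
  have : Fact p.Prime := ⟨hpp⟩
  have hm5 : (k + l) + lam + 5 ≤ m := by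
    refine add_five_le_of_mul_rpow_le (by omega) (e := (1 : ℝ) / ((k + l - 2 : ℕ) : ℝ))
      (by positivity) ?_
    convert hm2 using 4
    push_cast
    rfl
  have H : Params k l m lam p := ⟨hlk, hl, hkl, by omega, hp, hm5⟩
  have hτ : 5 ≤ τ * m := by
    rw [div_le_iff₀ hτ0] at hm1
    linarith
  have hinj : ∀ f : (Fin n → ZMod p) ≃+ ZMod p × (Fin (n - 1) → ZMod p),
      (f '' A).ncard = A.ncard := fun f => Set.ncard_image_of_injective _ f.injective
  obtain ⟨f, hf⟩ := hfree.sumFree.exists_isClassified H hn hfeas hτ hcard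
  have hi : ∀ e : (ZMod p × (Fin (n - 1) → ZMod p)) ≃+ (ZMod p × (Fin (n - 1) → ZMod p)),
      e '' (f '' A) = (f.trans e) '' A := by
    intro e
    rw [Set.image_image]
    rfl
  rcases hf with ⟨e, j, hj, h⟩ | ⟨h1, e, a, ha, h⟩ | ⟨h0, hn', h1, e, V, hV, h⟩
  · exact absurd ⟨f.trans e, j, hj, hi e ▸ h⟩ hnt
  · exact Or.inl ⟨hinj f ▸ h1, f.trans e, a, ha, hi e ▸ h⟩
  · exact Or.inr ⟨h0, by omega, hinj f ▸ h1, f.trans e, V, hV, hi e ▸ h⟩
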